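/- Let p > 1 and let n, m ∈ ℕ with n, m ≥ 2. There exists a constant c(n, m, p) > 0 such that for every nonempty open connected weakly mean convex set Ω ⊊ ℝⁿ and every u ∈ C_c^∞(Ω): ∫_Ω |Δ^{m/2} u|^p dx ≥ c(n, m, p) ∫_Ω |u|^p / d^{mp} dx, where for m even Δ^{m/2} u denotes the (m/2)-fold iterated Laplacian of u and for m odd |Δ^{m/2} u| denotes ‖∇(Δ^{(m−1)/2} u)‖. -/

import Mathlib

open MeasureTheory Real
open scoped RealInnerProductSpace

/-- The Laplacian of a function on Euclidean space, as the sum of the second partial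
derivatives in the coordinate directions. -/
noncomputable def laplacian {n : ℕ} (u : EuclideanSpace ℝ (Fin n) → ℝ) :
    EuclideanSpace ℝ (Fin n) → ℝ :=
  fun x => ∑ i : Fin n,
    fderiv ℝ (fun y => fderiv ℝ u y (EuclideanSpace.single i (1 : ℝ))) x
      (EuclideanSpace.single i (1 : ℝ))

/-- `|Δ^{m/2} u x|`: for even `m` this is the absolute value of the `(m/2)`-fold iterated
Laplacian of `u` at `x`, and for odd `m` it is `‖∇(Δ^{(m−1)/2} u)(x)‖`
(note `m / 2 = (m - 1) / 2` in natural number division when `m` is odd). -/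
noncomputable def halfLaplacianAbs {n : ℕ} (m : ℕ) (u : EuclideanSpace ℝ (Fin n) → ℝ)
    (x : EuclideanSpace ℝ (Fin n)) : ℝ :=
  if Even m then |laplacian^[m / 2] u x| else ‖gradient (laplacian^[m / 2] u) x‖

section BellmanFunction

theorem two_mul_abs_rpow_add_le {p : ℝ} (hp : 2 ≤ p) (a w : ℝ) :
    2 * |a| ^ p + 2 * (w ^ 2 * (a ^ 2 + w ^ 2) ^ ((p - 2) / 2)) ≤ |a + w| ^ p + |a - w| ^ p := by
  have key : ∀ x : ℝ, |x| ^ p = (x ^ 2) ^ (p / 2) := fun x => by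
    rw [← sq_abs, ← rpow_natCast, ← rpow_mul (abs_nonneg x)]
    congr 1; push_cast; ring
  have hconv : (1 / 2 * (a + w) ^ 2 + 1 / 2 * (a - w) ^ 2) ^ (p / 2) ≤
      1 / 2 * ((a + w) ^ 2) ^ (p / 2) + 1 / 2 * ((a - w) ^ 2) ^ (p / 2) :=
    (convexOn_rpow (by linarith : 1 ≤ p / 2)).2 (sq_nonneg (a + w)) (sq_nonneg (a - w))
      (by norm_num) (by norm_num) (by norm_num)
  rw [show 1 / 2 * (a + w) ^ 2 + 1 / 2 * (a - w) ^ 2 = a ^ 2 + w ^ 2 by ring] at hconv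
  have hsplit : ∀ y : ℝ, 0 ≤ y → y ^ (p / 2) = y * y ^ ((p - 2) / 2) := fun y hy => by
    rcases hy.eq_or_lt with rfl | hy
    · rw [zero_rpow (by linarith), zero_mul]
    · rw [← rpow_one_add' hy.le (by linarith)]; congr 1; ring
  have h1 : (a ^ 2) ^ ((p - 2) / 2) ≤ (a ^ 2 + w ^ 2) ^ ((p - 2) / 2) :=
    rpow_le_rpow (sq_nonneg _) (by nlinarith [sq_nonneg w]) (by linarith)
  rw [hsplit _ (by positivity)] at hconv
  rw [key, key, key, hsplit (a ^ 2) (sq_nonneg _)]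
  nlinarith [mul_le_mul_of_nonneg_left h1 (sq_nonneg a)]

theorem two_add_le_one_add_rpow {q : ℝ} (hq : 1 < q) (hq' : q ≤ 2) {t : ℝ} (ht : 0 ≤ t)
    (ht' : t ≤ 1) : 2 + q * (q - 1) / 2 * t ^ 2 ≤ (1 + t) ^ q + (1 - t) ^ q := by
  let f : ℝ → ℝ := fun t => (1 + t) ^ q + (1 - t) ^ q - q * (q - 1) / 2 * t ^ 2
  have hmono : MonotoneOn f (Set.Icc 0 1) := by
    refine monotoneOn_of_hasDerivWithinAt_nonneg (convex_Icc 0 1)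
      (f' := fun t => q * (1 + t) ^ (q - 1) - q * (1 - t) ^ (q - 1) - q * (q - 1) * t) ?_ ?_ ?_
    · have h1 : Continuous fun t : ℝ => (1 + t) ^ q :=
        (by fun_prop : Continuous fun t : ℝ => 1 + t).rpow_const fun _ => Or.inr (by linarith)
      have h2 : Continuous fun t : ℝ => (1 - t) ^ q :=
        (by fun_prop : Continuous fun t : ℝ => 1 - t).rpow_const fun _ => Or.inr (by linarith)
      exact ((h1.add h2).sub (by fun_prop)).continuousOn
    · intro x _
      have h1 := ((hasDerivAt_id x).const_add 1).rpow_const (p := q) (Or.inr hq.le)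
      have h2 := ((hasDerivAt_id x).const_sub 1).rpow_const (p := q) (Or.inr hq.le)
      have h3 := (hasDerivAt_pow 2 x).const_mul (q * (q - 1) / 2)
      refine (HasDerivAt.congr_deriv (f := f) ((h1.add h2).sub h3) ?_).hasDerivWithinAt
      simp
      ring
    · intro x hx
      rw [interior_Icc] at hx
      have h1 : (1 : ℝ) ≤ (1 + x) ^ (q - 1) := one_le_rpow (by linarith [hx.1]) (by linarith)
      have h2 : (1 + -x) ^ (q - 1) ≤ 1 + (q - 1) * -x :=
        rpow_one_add_le_one_add_mul_self (by linarith [hx.2]) (by linarith) (by linarith)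
      rw [← sub_eq_add_neg] at h2
      nlinarith [mul_le_mul_of_nonneg_left h1 (show 0 ≤ q by linarith),
        mul_le_mul_of_nonneg_left h2 (show 0 ≤ q by linarith)]
  have := hmono (by simp) (Set.mem_Icc.2 ⟨ht, ht'⟩) ht
  simp [f] at this
  linarith

theorem two_mul_rpow_add_le_of_le {q : ℝ} (hq : 1 < q) (hq' : q ≤ 2) {x y : ℝ} (hx : 0 < x)
    (hy : 0 ≤ y) (hyx : y ≤ x) :
    2 * x ^ q + q * (q - 1) / 2 * (y ^ 2 * x ^ (q - 2)) ≤ (x + y) ^ q + (x - y) ^ q := by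
  have h := two_add_le_one_add_rpow hq hq' (div_nonneg hy hx.le) ((div_le_one hx).2 hyx)
  have h1 : (x + y) ^ q = x ^ q * (1 + y / x) ^ q := by
    rw [← mul_rpow hx.le (by positivity)]; congr 1; field_simp
  have h2 : (x - y) ^ q = x ^ q * (1 - y / x) ^ q := by
    rw [← mul_rpow hx.le (by rw [sub_nonneg]; exact (div_le_one hx).2 hyx)]; congr 1; field_simp
  have h3 : x ^ (q - 2) = x ^ q / x ^ 2 := by
    rw [rpow_sub hx]; norm_cast
  rw [h1, h2, h3]
  have := mul_le_mul_of_nonneg_left h (rpow_nonneg hx.le q)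
  calc _ = x ^ q * (2 + q * (q - 1) / 2 * (y / x) ^ 2) := by field_simp
    _ ≤ _ := by linarith

theorem two_mul_abs_rpow_add_le_of_le_two {q : ℝ} (hq : 1 < q) (hq' : q ≤ 2) {b w M : ℝ}
    (hb : |b| ≤ M) (hw : |w| ≤ M) :
    2 * |b| ^ q + q * (q - 1) / 2 * (w ^ 2 * M ^ (q - 2)) ≤ |b + w| ^ q + |b - w| ^ q := by
  have hc : 0 ≤ q * (q - 1) / 2 := by nlinarith
  have hc1 : q * (q - 1) / 2 ≤ 1 := by nlinarith
  have hsym : |b + w| ^ q + |b - w| ^ q = (|b| + |w|) ^ q + |(|b| - |w|)| ^ q := by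
    rcases abs_cases b with ⟨h1, _⟩ | ⟨h1, _⟩ <;> rcases abs_cases w with ⟨h2, _⟩ | ⟨h2, _⟩ <;>
      rw [h1, h2]
    · rw [abs_of_nonneg (by linarith : 0 ≤ b + w)]
    · rw [abs_of_nonneg (by linarith : 0 ≤ b - w), show b - -w = b + w by ring, add_comm]; rfl
    · rw [show -b - w = -(b + w) by ring, abs_neg, abs_of_nonpos (by linarith : b - w ≤ 0),
        add_comm, show -b + w = -(b - w) by ring]
    · rw [show -b - -w = -(b - w) by ring, abs_neg, abs_of_nonpos (by linarith : b + w ≤ 0),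
        show -b + -w = -(b + w) by ring]
  rw [hsym, ← sq_abs w]
  have hsq : ∀ x : ℝ, 0 < x → x ^ 2 * x ^ (q - 2) = x ^ q := fun x hx => by
    rw [rpow_sub hx]; norm_cast; field_simp
  have hmon : ∀ x : ℝ, 0 < x → x ≤ M → M ^ (q - 2) ≤ x ^ (q - 2) := fun x hx hxM =>
    rpow_le_rpow_of_nonpos hx hxM (by linarith)
  have hx := abs_nonneg b
  have hy := abs_nonneg w
  generalize |b| = x at *
  generalize |w| = y at *
  rcases le_or_gt y x with hyx | hxy
  · rcases hx.eq_or_lt with rfl | hx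
    · obtain rfl : y = 0 := le_antisymm hyx hy
      simp [zero_rpow (by linarith : q ≠ 0)]
    · rw [abs_of_nonneg (by linarith)]
      refine le_trans ?_ (two_mul_rpow_add_le_of_le hq hq' hx hy hyx)
      have := hmon x hx hb
      gcongr
  · have hy : 0 < y := hx.trans_lt hxy
    rw [abs_of_nonpos (by linarith), neg_sub, add_comm x y]
    refine le_trans ?_ (two_mul_rpow_add_le_of_le hq hq' hy hx hxy.le)
    have h1 := hmon y hy hw
    have h2 : x ^ q ≤ x * (y * y ^ (q - 2)) := by
      rcases hx.eq_or_lt with rfl | hx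
      · simp [zero_rpow (by linarith : q ≠ 0)]
      · have : x ^ q = x * x ^ (q - 1) := by
          rw [← rpow_one_add' hx.le (by linarith)]; congr 1; ring
        rw [this, ← rpow_one_add' hy.le (by linarith)]
        gcongr
        calc x ^ (q - 1) ≤ y ^ (q - 1) := rpow_le_rpow hx.le hxy.le (by linarith)
          _ = _ := by congr 1; ring
    rw [← hsq y hy]
    have hY := rpow_pos_of_pos hy (q - 2)
    generalize y ^ (q - 2) = Y at *
    generalize q * (q - 1) / 2 = c at *
    have h3 : c * (y ^ 2 * M ^ (q - 2)) ≤ c * (y ^ 2 * Y) := by gcongr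
    have h4 : 0 ≤ (y - x) * (2 * y - c * (x + y)) := by
      apply mul_nonneg (by linarith)
      nlinarith
    nlinarith [mul_nonneg h4 hY.le]

/-- A function with the concavity-type jump needed for bilinear estimates at exponents `p`, `q`. -/
def IsBellman (p q C : ℝ) (Q : ℝ → ℝ → ℝ) : Prop :=
  Continuous (Function.uncurry Q) ∧ (∀ a b, 0 ≤ Q a b) ∧
  (∀ a b, Q a b ≤ C * (|a| ^ p + |b| ^ q)) ∧
  ∀ a b v w, 2 * Q a b + |v| * |w| ≤ Q (a + v) (b + w) + Q (a - v) (b - w)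

/-- The Bellman function `K|b|^q + max (a²|b|^{2-q}) (|a|^p)`. -/
noncomputable def bellman (p q K a b : ℝ) : ℝ :=
  K * |b| ^ q + max (a ^ 2 * |b| ^ (2 - q)) (|a| ^ p)

theorem abs_mul_abs_le_rpow_add {p q : ℝ} (h : p.HolderConjugate q) (a b : ℝ) :
    |a| * |b| ≤ |a| ^ p + |b| ^ q := by
  have := Real.young_inequality_of_nonneg (abs_nonneg a) (abs_nonneg b) h
  have h1 := div_le_self (rpow_nonneg (abs_nonneg a) p) h.lt.le
  have h2 := div_le_self (rpow_nonneg (abs_nonneg b) q) h.symm.lt.le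
  linarith

theorem sq_mul_rpow_le {p q : ℝ} (h : p.HolderConjugate q) {a b : ℝ}
    (hab : |a| ≤ |b| ^ (q - 1)) : a ^ 2 * |b| ^ (2 - q) ≤ |b| ^ q := by
  have hq := h.symm.lt
  rcases (abs_nonneg b).eq_or_lt with hb | hb
  · rw [← hb, zero_rpow (by linarith)] at hab
    have : a = 0 := abs_nonpos_iff.1 hab
    simp [this]; positivity
  · calc a ^ 2 * |b| ^ (2 - q) ≤ (|b| ^ (q - 1)) ^ 2 * |b| ^ (2 - q) := by
          rw [← sq_abs a]; gcongr
      _ = |b| ^ q := by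
          rw [← rpow_natCast, ← rpow_mul hb.le, ← rpow_add hb]; congr 1; push_cast; ring

theorem sq_mul_rpow_le' {p q : ℝ} (h : p.HolderConjugate q) (hp : 2 ≤ p) (hq : q ≤ 2) {a b : ℝ}
    (hab : |b| ≤ |a| ^ (p - 1)) : a ^ 2 * |b| ^ (2 - q) ≤ |a| ^ p := by
  rcases (abs_nonneg a).eq_or_lt with ha | ha
  · have : a = 0 := abs_eq_zero.1 ha.symm
    simp [this, zero_rpow (by linarith : p ≠ 0)]
  · calc a ^ 2 * |b| ^ (2 - q) ≤ |a| ^ 2 * (|a| ^ (p - 1)) ^ (2 - q) := by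
          rw [← sq_abs a]; gcongr
      _ = |a| ^ p := by
          rw [← rpow_natCast, ← rpow_mul ha.le, ← rpow_add ha]; congr 1; push_cast
          have := h.mul_eq_add; linarith

theorem abs_rpow_le_sq_mul_rpow {p q : ℝ} (h : p.HolderConjugate q) (hp : 2 ≤ p) {a b : ℝ}
    (hab : |a| ≤ |b| ^ (q - 1)) : |a| ^ p ≤ a ^ 2 * |b| ^ (2 - q) := by
  rcases (abs_nonneg a).eq_or_lt with ha | ha
  · rw [← ha, zero_rpow (by linarith)]
    positivity
  · calc |a| ^ p = |a| ^ 2 * |a| ^ (p - 2) := by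
          rw [← rpow_natCast, ← rpow_add ha]; congr 1; push_cast; ring
      _ ≤ |a| ^ 2 * (|b| ^ (q - 1)) ^ (p - 2) := by gcongr
      _ = a ^ 2 * |b| ^ (2 - q) := by
          rw [sq_abs, ← rpow_mul (abs_nonneg b)]
          congr 2
          have := h.mul_eq_add; linarith

theorem two_sub_le_one_add_rpow {r t : ℝ} (hr' : r ≤ 1) (ht : |t| ≤ 1 / 2) :
    2 - 2 * t ^ 2 ≤ (1 + t) ^ r + (1 - t) ^ r := by
  obtain ⟨h1, h2⟩ := abs_le.1 ht
  have hprod : 1 - t ^ 2 ≤ (1 + t) ^ r * (1 - t) ^ r := by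
    rw [← mul_rpow (by linarith) (by linarith), show (1 + t) * (1 - t) = 1 - t ^ 2 by ring]
    exact self_le_rpow_of_le_one (by nlinarith) (by nlinarith) hr'
  have hx : 0 ≤ (1 + t) ^ r := rpow_nonneg (by linarith) _
  have hy : 0 ≤ (1 - t) ^ r := rpow_nonneg (by linarith) _
  have ht2 : t ^ 2 ≤ 1 / 4 := by nlinarith
  by_contra! hlt
  nlinarith [sq_nonneg ((1 + t) ^ r - (1 - t) ^ r), sq_nonneg t]

theorem abs_one_add_rpow_sub_le {r t : ℝ} (hr : 0 ≤ r) (hr' : r ≤ 1) (ht : |t| ≤ 1 / 2) :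
    |(1 + t) ^ r - (1 - t) ^ r| ≤ 2 * |t| := by
  have key : ∀ s : ℝ, 0 ≤ s → s ≤ 1 / 2 →
      0 ≤ (1 + s) ^ r - (1 - s) ^ r ∧ (1 + s) ^ r - (1 - s) ^ r ≤ 2 * s := fun s hs hs' => by
    have h1 : (1 + s) ^ r ≤ 1 + r * s := rpow_one_add_le_one_add_mul_self (by linarith) hr hr'
    have h2 : 1 - s ≤ (1 - s) ^ r := self_le_rpow_of_le_one (by linarith) (by linarith) hr'
    have h3 : (1 - s) ^ r ≤ (1 + s) ^ r := rpow_le_rpow (by linarith) (by linarith) hr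
    constructor <;> nlinarith
  rcases abs_cases t with ⟨h, h0⟩ | ⟨h, h0⟩
  · obtain ⟨h1, h2⟩ := key t h0 (h ▸ ht)
    rw [h, abs_of_nonneg h1]; exact h2
  · obtain ⟨h1, h2⟩ := key (-t) (by linarith) (h ▸ ht)
    rw [sub_neg_eq_add, ← sub_eq_add_neg] at h1 h2
    rw [h, abs_sub_comm, abs_of_nonneg h1]; exact h2

theorem bellman_midpoint_of_pos {p q : ℝ} (h : p.HolderConjugate q) (hp : 2 ≤ p) (hq' : q ≤ 2)
    {a b v w : ℝ} (hb : 0 < b) (hab : |a| ≤ b ^ (q - 1)) (hw : 2 * |w| < b) :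
    2 * bellman p q (20 / (q * (q - 1) / 2)) a b + |v| * |w| ≤
      bellman p q (20 / (q * (q - 1) / 2)) (a + v) (b + w) +
        bellman p q (20 / (q * (q - 1) / 2)) (a - v) (b - w) := by
  have hq := h.symm.lt
  have hc : 0 < q * (q - 1) / 2 := by nlinarith
  have hbabs : |b| = b := abs_of_pos hb
  obtain ⟨hw1, hw2⟩ := abs_le.1 (by linarith : |w| ≤ b / 2)
  have hgain := two_mul_abs_rpow_add_le_of_le_two hq hq' (b := b) (w := w) (M := b) hbabs.le
    (by linarith [abs_nonneg w])
  have hmax : max (a ^ 2 * |b| ^ (2 - q)) (|a| ^ p) = a ^ 2 * b ^ (2 - q) := by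
    rw [hbabs]
    exact max_eq_left
      (by simpa [hbabs] using abs_rpow_le_sq_mul_rpow (b := b) h hp (by rwa [hbabs]))
  have ht : |w / b| ≤ 1 / 2 := by
    rw [abs_div, hbabs, div_le_iff₀ hb]; linarith
  have hS := two_sub_le_one_add_rpow (r := 2 - q) (by linarith) ht
  have hD := abs_one_add_rpow_sub_le (r := 2 - q) (by linarith) (by linarith) ht
  obtain ⟨ht1, ht2⟩ := abs_le.1 ht
  have hp1 : |b + w| ^ (2 - q) = b ^ (2 - q) * (1 + w / b) ^ (2 - q) := by
    rw [abs_of_nonneg (by linarith), ← mul_rpow hb.le (by linarith)]; congr 1; field_simp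
  have hm1 : |b - w| ^ (2 - q) = b ^ (2 - q) * (1 - w / b) ^ (2 - q) := by
    rw [abs_of_nonneg (by linarith), ← mul_rpow hb.le (by linarith)]; congr 1; field_simp
  have hp2 := le_max_left ((a + v) ^ 2 * |b + w| ^ (2 - q)) (|a + v| ^ p)
  have hm2 := le_max_left ((a - v) ^ 2 * |b - w| ^ (2 - q)) (|a - v| ^ p)
  have hBpos : 0 < b ^ (2 - q) := rpow_pos_of_pos hb _
  have hBinv : b ^ (q - 2) = (b ^ (2 - q))⁻¹ := by
    rw [← rpow_neg hb.le]; congr 1; ring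
  have haB : |a| * b ^ (2 - q) ≤ b := by
    calc |a| * b ^ (2 - q) ≤ b ^ (q - 1) * b ^ (2 - q) := by gcongr
      _ = b := by rw [← rpow_add hb]; norm_num
  unfold bellman
  rw [hmax]
  rw [hp1] at hp2 ⊢
  rw [hm1] at hm2 ⊢
  rw [hBinv, hbabs] at hgain
  rw [hbabs]
  have hgain' := mul_le_mul_of_nonneg_left hgain (div_pos (by norm_num : (0:ℝ) < 20) hc).le
  have hcancel : 20 / (q * (q - 1) / 2) * (q * (q - 1) / 2) = 20 := div_mul_cancel₀ _ hc.ne'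
  generalize 20 / (q * (q - 1) / 2) = K at *
  generalize q * (q - 1) / 2 = c at *
  generalize b ^ (2 - q) = B at *
  generalize (1 + w / b) ^ (2 - q) = x at *
  generalize (1 - w / b) ^ (2 - q) = y at *
  have hgain'' : K * (2 * b ^ q) + 20 * (w ^ 2 * B⁻¹) ≤ K * |b + w| ^ q + K * |b - w| ^ q := by
    calc _ = K * (2 * b ^ q) + K * c * (w ^ 2 * B⁻¹) := by rw [hcancel]
      _ = K * (2 * b ^ q + c * (w ^ 2 * B⁻¹)) := by ring
      _ ≤ _ := by rw [← mul_add]; exact hgain'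
  have htb : |w / b| * b = |w| := by rw [abs_div, hbabs]; field_simp
  have e1 : B * (a ^ 2 * (w / b) ^ 2) ≤ w ^ 2 * B⁻¹ := by
    have : (|a| * B) ^ 2 ≤ b ^ 2 := by gcongr
    calc B * (a ^ 2 * (w / b) ^ 2) = (|a| * B) ^ 2 * (w / b) ^ 2 * B⁻¹ := by
          rw [mul_pow, sq_abs]; field_simp
      _ ≤ b ^ 2 * (w / b) ^ 2 * B⁻¹ := by gcongr
      _ = _ := by field_simp
  have e2 : B * (|a| * |v| * |w / b|) ≤ |v| * |w| := by
    calc B * (|a| * |v| * |w / b|) = (|a| * B) * (|v| * |w / b|) := by ring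
      _ ≤ b * (|v| * |w / b|) := by gcongr
      _ = |v| * |w| := by rw [← htb]; ring
  have e3 : -(B * (|a| * |v| * (2 * |w / b|))) ≤ B * (a * v * (x - y)) := by
    have : |B * (a * v * (x - y))| ≤ B * (|a| * |v| * (2 * |w / b|)) := by
      rw [abs_mul, abs_mul, abs_mul, abs_of_pos hBpos]
      gcongr
    exact (abs_le.1 this).1
  have e4 : B * ((a ^ 2 + v ^ 2) * (2 - 2 * (w / b) ^ 2)) ≤ B * ((a ^ 2 + v ^ 2) * (x + y)) := by
    gcongr
  have e5 : B * (v ^ 2 * (w / b) ^ 2) ≤ B * (v ^ 2 * (1 / 4)) := by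
    gcongr
    rw [← sq_abs]; nlinarith [abs_nonneg (w / b)]
  have e6 : 4 * (|v| * |w|) ≤ v ^ 2 * B + 4 * (w ^ 2 * B⁻¹) := by
    have : 0 ≤ (|v| * B - 2 * |w|) ^ 2 * B⁻¹ := by positivity
    have e : (|v| * B - 2 * |w|) ^ 2 * B⁻¹ = v ^ 2 * B + 4 * (w ^ 2 * B⁻¹) - 4 * (|v| * |w|) := by
      rw [← sq_abs v, ← sq_abs w]; field_simp; ring
    linarith
  have e7 : 0 ≤ w ^ 2 * B⁻¹ := by positivity
  have e8 : 0 ≤ v ^ 2 * B := by positivity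
  linarith

theorem bellman_midpoint {p q : ℝ} (h : p.HolderConjugate q) (hp : 2 ≤ p) (hq' : q ≤ 2)
    (a b v w : ℝ) :
    2 * bellman p q (20 / (q * (q - 1) / 2)) a b + |v| * |w| ≤
      bellman p q (20 / (q * (q - 1) / 2)) (a + v) (b + w) +
        bellman p q (20 / (q * (q - 1) / 2)) (a - v) (b - w) := by
  have hq := h.symm.lt
  have hc : 0 < q * (q - 1) / 2 := by nlinarith
  have hpq := h.mul_eq_add
  have hP := two_mul_abs_rpow_add_le hp a v
  have hG : ∀ M, |b| ≤ M → |w| ≤ M →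
      20 / (q * (q - 1) / 2) * (2 * |b| ^ q) + 20 * (w ^ 2 * M ^ (q - 2)) ≤
      20 / (q * (q - 1) / 2) * |b + w| ^ q + 20 / (q * (q - 1) / 2) * |b - w| ^ q := by
    intro M hb hw
    have := mul_le_mul_of_nonneg_left (two_mul_abs_rpow_add_le_of_le_two hq hq' hb hw)
      (div_pos (by norm_num : (0:ℝ) < 20) hc).le
    have hcancel : 20 / (q * (q - 1) / 2) * (q * (q - 1) / 2) = 20 := div_mul_cancel₀ _ hc.ne'
    calc _ = 20 / (q * (q - 1) / 2) * (2 * |b| ^ q) +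
          20 / (q * (q - 1) / 2) * (q * (q - 1) / 2) * (w ^ 2 * M ^ (q - 2)) := by rw [hcancel]
      _ = 20 / (q * (q - 1) / 2) * (2 * |b| ^ q + q * (q - 1) / 2 * (w ^ 2 * M ^ (q - 2))) := by
        ring
      _ ≤ _ := by rw [← mul_add]; exact this
  have hp2 := le_max_right ((a + v) ^ 2 * |b + w| ^ (2 - q)) (|a + v| ^ p)
  have hm2 := le_max_right ((a - v) ^ 2 * |b - w| ^ (2 - q)) (|a - v| ^ p)
  have hwq : 0 < |w| → w ^ 2 * |w| ^ (q - 2) = |w| ^ q := fun hw => by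
    rw [← sq_abs, ← rpow_natCast, ← rpow_add hw]; congr 1; push_cast; ring
  rcases le_or_gt |b| (|a| ^ (p - 1)) with hba | hba
  · have hmax : max (a ^ 2 * |b| ^ (2 - q)) (|a| ^ p) = |a| ^ p :=
      max_eq_right (sq_mul_rpow_le' h hp hq' hba)
    unfold bellman
    rw [hmax]
    by_cases hvw : |v| * |w| = 0
    · have hM := le_max_left |b| |w|
      have h1 := hG _ hM (le_max_right _ _)
      have h2 : 0 ≤ w ^ 2 * max |b| |w| ^ (q - 2) := by positivity
      have h3 : 0 ≤ v ^ 2 * (a ^ 2 + v ^ 2) ^ ((p - 2) / 2) := by positivity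
      linarith
    obtain ⟨hv, hw⟩ := mul_ne_zero_iff.1 hvw
    have hv : 0 < |v| := lt_of_le_of_ne (abs_nonneg v) (Ne.symm hv)
    have hw : 0 < |w| := lt_of_le_of_ne (abs_nonneg w) (Ne.symm hw)
    have hR : 0 < a ^ 2 + v ^ 2 := by have := pow_pos hv 2; rw [sq_abs] at this; positivity
    have hpow : ∀ x s : ℝ, |x| ^ s = (x ^ 2) ^ (s / 2) := fun x s => by
      rw [← sq_abs, ← rpow_natCast, ← rpow_mul (abs_nonneg x)]
      congr 1; push_cast; ring
    rcases le_or_gt |w| ((a ^ 2 + v ^ 2) ^ ((p - 1) / 2)) with hwA | hwA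
    · have h1 := hG _ (hba.trans (by
        rw [hpow]
        exact rpow_le_rpow (sq_nonneg _) (by nlinarith [sq_nonneg v]) (by linarith))) hwA
      have hY : 0 < (a ^ 2 + v ^ 2) ^ ((p - 2) / 2) := rpow_pos_of_pos hR _
      have h2 : ((a ^ 2 + v ^ 2) ^ ((p - 1) / 2)) ^ (q - 2) =
          ((a ^ 2 + v ^ 2) ^ ((p - 2) / 2))⁻¹ := by
        rw [← rpow_mul hR.le, ← rpow_neg hR.le]; congr 1; linarith
      rw [h2] at h1
      generalize (a ^ 2 + v ^ 2) ^ ((p - 2) / 2) = Y at *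
      have h3 : 2 * (|v| * |w|) ≤ v ^ 2 * Y + w ^ 2 * Y⁻¹ := by
        have : 0 ≤ (|v| * Y - |w|) ^ 2 * Y⁻¹ := by positivity
        have e : (|v| * Y - |w|) ^ 2 * Y⁻¹ = v ^ 2 * Y + w ^ 2 * Y⁻¹ - 2 * (|v| * |w|) := by
          rw [← sq_abs v, ← sq_abs w]; field_simp; ring
        linarith
      have h4 : 0 ≤ v ^ 2 * Y := by positivity
      have h5 : 0 ≤ w ^ 2 * Y⁻¹ := by positivity
      nlinarith
    · have hbw : |b| ≤ |w| := by
        refine hba.trans (le_trans ?_ hwA.le)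
        rw [hpow]
        exact rpow_le_rpow (sq_nonneg _) (by nlinarith [sq_nonneg v]) (by linarith)
      have h1 := hG _ hbw le_rfl
      rw [hwq hw] at h1
      have h2 : |v| * |w| ≤ |w| ^ q := by
        calc |v| * |w| ≤ |w| ^ (q - 1) * |w| := by
              gcongr
              calc |v| = |v| ^ (1 : ℝ) := (rpow_one _).symm
                _ = (v ^ 2) ^ ((1 : ℝ) / 2) := hpow _ _
                _ ≤ (a ^ 2 + v ^ 2) ^ ((1 : ℝ) / 2) :=
                  rpow_le_rpow (sq_nonneg _) (by nlinarith [sq_nonneg a]) (by norm_num)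
                _ = ((a ^ 2 + v ^ 2) ^ ((p - 1) / 2)) ^ (q - 1) := by
                  rw [← rpow_mul hR.le]; congr 1; linarith
                _ ≤ |w| ^ (q - 1) := rpow_le_rpow (by positivity) hwA.le (by linarith)
          _ = |w| ^ q := by rw [← rpow_add_one hw.ne']; congr 1; ring
      have h3 : 0 ≤ v ^ 2 * (a ^ 2 + v ^ 2) ^ ((p - 2) / 2) := by positivity
      have h4 : 0 ≤ |w| ^ q := by positivity
      linarith
  · have hab : |a| ≤ |b| ^ (q - 1) := by
      calc |a| = (|a| ^ (p - 1)) ^ (q - 1) := by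
            rw [← rpow_mul (abs_nonneg a), show (p - 1) * (q - 1) = 1 by linarith, rpow_one]
        _ ≤ |b| ^ (q - 1) := rpow_le_rpow (by positivity) hba.le (by linarith)
    have hb : 0 < |b| := lt_of_le_of_lt (by positivity) hba
    rcases le_or_gt |b| (2 * |w|) with hbw | hbw
    · have hw : 0 < |w| := by linarith
      have h1 := hG _ hbw (by linarith)
      have h2 : |w| ^ q ≤ 2 * (w ^ 2 * (2 * |w|) ^ (q - 2)) := by
        rw [mul_rpow (by norm_num) hw.le]
        have h3 : (2 : ℝ) ^ (-1 : ℝ) ≤ 2 ^ (q - 2) :=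
          rpow_le_rpow_of_exponent_le (by norm_num) (by linarith)
        rw [rpow_neg_one] at h3
        have h4 : 0 ≤ |w| ^ q := by positivity
        rw [show w ^ 2 * (2 ^ (q - 2) * |w| ^ (q - 2)) = 2 ^ (q - 2) * (w ^ 2 * |w| ^ (q - 2)) by
          ring, hwq hw]
        nlinarith
      have hmax : max (a ^ 2 * |b| ^ (2 - q)) (|a| ^ p) ≤ 4 * |w| ^ q := by
        rw [max_eq_left (abs_rpow_le_sq_mul_rpow h hp hab)]
        calc _ ≤ |b| ^ q := sq_mul_rpow_le h hab
          _ ≤ (2 * |w|) ^ q := by gcongr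
          _ = 2 ^ q * |w| ^ q := mul_rpow (by norm_num) hw.le
          _ ≤ 2 ^ (2 : ℝ) * |w| ^ q := by gcongr; norm_num
          _ = 4 * |w| ^ q := by norm_num
      have h5 : |v| ^ p ≤ v ^ 2 * (a ^ 2 + v ^ 2) ^ ((p - 2) / 2) := by
        have : |v| ^ p = v ^ 2 * (v ^ 2) ^ ((p - 2) / 2) := by
          rcases eq_or_ne v 0 with rfl | hv
          · simp [zero_rpow (by linarith : p ≠ 0)]
          · have hv2 : 0 < v ^ 2 := by positivity
            rw [← rpow_one_add' hv2.le (by linarith), ← sq_abs, ← rpow_natCast,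
              ← rpow_mul (abs_nonneg v)]
            congr 1; push_cast; ring
        rw [this]
        gcongr
        nlinarith [sq_nonneg a]
      have h6 := abs_mul_abs_le_rpow_add h v w
      have h7 : 0 ≤ |a| ^ p := by positivity
      have h8 : 0 ≤ |v| ^ p := by positivity
      have h9 : 0 ≤ |w| ^ q := by positivity
      unfold bellman
      linarith
    · rcases abs_cases b with ⟨hb', hb0⟩ | ⟨hb', hb0⟩
      · rw [hb'] at hab hbw hb
        exact bellman_midpoint_of_pos h hp hq' hb hab hbw
      · rw [hb'] at hab hbw hb
        have := bellman_midpoint_of_pos (v := v) (w := -w) h hp hq' hb hab (by rwa [abs_neg])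
        have e1 : |-b + -w| = |b + w| := by rw [← abs_neg]; congr 1; ring
        have e2 : |-b - -w| = |b - w| := by rw [← abs_neg]; congr 1; ring
        simpa only [bellman, abs_neg, e1, e2] using this

theorem exists_isBellman {p q : ℝ} (h : p.HolderConjugate q) :
    ∃ C : ℝ, 0 < C ∧ ∃ Q, IsBellman p q C Q := by
  have key : ∀ {p q : ℝ}, p.HolderConjugate q → 2 ≤ p →
      ∃ C : ℝ, 0 < C ∧ ∃ Q, IsBellman p q C Q := by
    intro p q h hp
    have hq := h.symm.lt
    have hq' : q ≤ 2 := by have := h.mul_eq_add; nlinarith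
    have hc : 0 < q * (q - 1) / 2 := by nlinarith
    have hK := div_pos (by norm_num : (0:ℝ) < 20) hc
    refine ⟨20 / (q * (q - 1) / 2) + 1, by linarith, bellman p q (20 / (q * (q - 1) / 2)),
      ?_, ?_, ?_, bellman_midpoint h hp hq'⟩
    · have h1 : ∀ s : ℝ, 0 ≤ s → Continuous fun x : ℝ × ℝ => |x.2| ^ s := fun s hs =>
        (by fun_prop : Continuous fun x : ℝ × ℝ => |x.2|).rpow_const fun _ => Or.inr hs
      have h2 : Continuous fun x : ℝ × ℝ => |x.1| ^ p :=
        (by fun_prop : Continuous fun x : ℝ × ℝ => |x.1|).rpow_const fun _ => Or.inr (by linarith)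
      exact ((h1 q (by linarith)).const_mul _).add
        ((((by fun_prop : Continuous fun x : ℝ × ℝ => x.1 ^ 2)).mul
          (h1 (2 - q) (by linarith))).max h2)
    · intro a b
      have : 0 ≤ max (a ^ 2 * |b| ^ (2 - q)) (|a| ^ p) := le_max_of_le_right (by positivity)
      unfold bellman
      positivity
    · intro a b
      have h1 : max (a ^ 2 * |b| ^ (2 - q)) (|a| ^ p) ≤ |a| ^ p + |b| ^ q := by
        have ha : 0 ≤ |a| ^ p := by positivity
        have hb : 0 ≤ |b| ^ q := by positivity
        refine max_le ?_ (by linarith)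
        rcases le_or_gt |b| (|a| ^ (p - 1)) with hba | hba
        · linarith [sq_mul_rpow_le' h hp hq' hba]
        · have hab : |a| ≤ |b| ^ (q - 1) := by
            calc |a| = (|a| ^ (p - 1)) ^ (q - 1) := by
                  rw [← rpow_mul (abs_nonneg a),
                    show (p - 1) * (q - 1) = 1 by linarith [h.mul_eq_add], rpow_one]
              _ ≤ |b| ^ (q - 1) := rpow_le_rpow (by positivity) hba.le (by linarith)
          linarith [sq_mul_rpow_le h hab]
      have h2 : 0 ≤ 20 / (q * (q - 1) / 2) * |a| ^ p := by positivity
      unfold bellman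
      linarith
  rcases le_total 2 p with hp | hp
  · exact key h hp
  · have hq : 2 ≤ q := by
      have := h.mul_eq_add
      have := h.lt
      have := h.symm.lt
      nlinarith
    obtain ⟨C, hC, Q, h1, h2, h3, h4⟩ := key h.symm hq
    refine ⟨C, hC, fun a b => Q b a, h1.comp continuous_swap, fun a b => h2 b a, fun a b => ?_,
      fun a b v w => ?_⟩
    · rw [add_comm]; exact h3 b a
    · simpa only [mul_comm |v|] using h4 b a w v

end BellmanFunction

section DiscreteEstimate

variable {E : Type*} [NormedAddCommGroup E]

/-- Symmetric average `(F (x + s) + F (x - s)) / 2`. -/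
noncomputable def symAvg (s : E) : Module.End ℝ (E → ℝ) where
  toFun F x := (F (x + s) + F (x - s)) / 2
  map_add' F G := by ext x; simp only [Pi.add_apply]; ring
  map_smul' c F := by ext x; simp only [Pi.smul_apply, smul_eq_mul, RingHom.id_apply]; ring

/-- Central difference `F (x + s) - F (x - s)`. -/
def centralDiff (s : E) : Module.End ℝ (E → ℝ) where
  toFun F x := F (x + s) - F (x - s)
  map_add' F G := by ext x; simp only [Pi.add_apply]; ring
  map_smul' c F := by ext x; simp only [Pi.smul_apply, smul_eq_mul, RingHom.id_apply]; ring

/-- Composition of the symmetric averages in the directions of a list. -/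
noncomputable def iterAvg (L : List E) : Module.End ℝ (E → ℝ) := (L.map symAvg).prod

theorem symAvg_apply (s : E) (F : E → ℝ) (x : E) :
    symAvg s F x = (F (x + s) + F (x - s)) / 2 := rfl

theorem centralDiff_apply (s : E) (F : E → ℝ) (x : E) :
    centralDiff s F x = F (x + s) - F (x - s) := rfl

theorem iterAvg_nil (F : E → ℝ) : iterAvg [] F = F := rfl

theorem iterAvg_cons (t : E) (L : List E) (F : E → ℝ) :
    iterAvg (t :: L) F = symAvg t (iterAvg L F) := rfl

theorem commute_symAvg (s t : E) : Commute (symAvg s) (symAvg t) := by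
  refine LinearMap.ext fun F => funext fun x => ?_
  simp only [Module.End.mul_apply, symAvg_apply]
  rw [add_right_comm x s t, show x + s - t = x - t + s by abel, show x - s + t = x + t - s by abel,
    show x - s - t = x - t - s by abel]
  ring

theorem commute_centralDiff_symAvg (s t : E) : Commute (centralDiff s) (symAvg t) := by
  refine LinearMap.ext fun F => funext fun x => ?_
  simp only [Module.End.mul_apply, symAvg_apply, centralDiff_apply]
  rw [add_right_comm x s t, show x + s - t = x - t + s by abel, show x - s + t = x + t - s by abel,
    show x - s - t = x - t - s by abel]
  ring

theorem commute_symAvg_iterAvg (s : E) (L : List E) : Commute (symAvg s) (iterAvg L) :=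
  Commute.list_prod_right _ _ fun _ hx => by
    obtain ⟨t, _, rfl⟩ := List.mem_map.1 hx; exact commute_symAvg s t

theorem commute_centralDiff_iterAvg (s : E) (L : List E) : Commute (centralDiff s) (iterAvg L) :=
  Commute.list_prod_right _ _ fun _ hx => by
    obtain ⟨t, _, rfl⟩ := List.mem_map.1 hx; exact commute_centralDiff_symAvg s t

/-- Continuous functions with compact support. -/
def IsCc (F : E → ℝ) : Prop := Continuous F ∧ HasCompactSupport F

namespace IsCc

variable {F G : E → ℝ}

theorem comp_add (hF : IsCc F) (s : E) : IsCc fun x => F (x + s) :=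
  ⟨hF.1.comp (by fun_prop), hF.2.comp_homeomorph (Homeomorph.addRight s)⟩

theorem comp_sub (hF : IsCc F) (s : E) : IsCc fun x => F (x - s) := by
  simpa only [sub_eq_add_neg] using hF.comp_add (-s)

theorem comp₂ {m : ℝ → ℝ → ℝ} (hm : Continuous (Function.uncurry m)) (h0 : m 0 0 = 0)
    (hF : IsCc F) (hG : IsCc G) : IsCc fun x => m (F x) (G x) :=
  ⟨hm.comp (hF.1.prodMk hG.1), hF.2.comp₂_left hG.2 h0⟩

theorem comp_left {m : ℝ → ℝ} (hm : Continuous m) (h0 : m 0 = 0)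
    (hF : IsCc F) : IsCc fun x => m (F x) :=
  ⟨hm.comp hF.1, hF.2.comp_left h0⟩

theorem add (hF : IsCc F) (hG : IsCc G) : IsCc fun x => F x + G x :=
  comp₂ (by fun_prop : Continuous (Function.uncurry fun a b : ℝ => a + b)) (by simp) hF hG

theorem sub (hF : IsCc F) (hG : IsCc G) : IsCc (F - G) :=
  comp₂ (m := fun a b => a - b) (by fun_prop) (by simp) hF hG

theorem mul (hF : IsCc F) (hG : IsCc G) : IsCc fun x => F x * G x :=
  comp₂ (by fun_prop : Continuous (Function.uncurry fun a b : ℝ => a * b)) (by simp) hF hG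

theorem abs_rpow {p : ℝ} (hp : 0 < p) (hF : IsCc F) : IsCc fun x => |F x| ^ p :=
  comp_left (m := fun t => |t| ^ p) (continuous_abs.rpow_const fun _ => Or.inr hp.le)
    (by simp [zero_rpow hp.ne']) hF

theorem symAvg (hF : IsCc F) (s : E) : IsCc (symAvg s F) :=
  ((hF.comp_add s).add (hF.comp_sub s)).comp_left (m := fun t => t / 2) (by fun_prop) (by simp)

theorem centralDiff (hF : IsCc F) (s : E) : IsCc (centralDiff s F) :=
  (hF.comp_add s).sub (hF.comp_sub s)

theorem iterAvg (hF : IsCc F) (L : List E) : IsCc (iterAvg L F) := by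
  induction L with
  | nil => exact hF
  | cons t L ih => exact ih.symAvg t

theorem iterAvg_pow (hF : IsCc F) (L : List E) (k : ℕ) : IsCc ((_root_.iterAvg L ^ k) F) := by
  induction k with
  | zero => exact hF
  | succ k ih => rw [pow_succ', Module.End.mul_apply]; exact ih.iterAvg L

theorem integrable [MeasurableSpace E] [BorelSpace E] {μ : Measure E}
    [IsFiniteMeasureOnCompacts μ] (hF : IsCc F) : Integrable F μ :=
  hF.1.integrable_of_hasCompactSupport hF.2

end IsCc

variable [MeasurableSpace E] [BorelSpace E] {μ : Measure E} [μ.IsAddRightInvariant]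
  {F G : E → ℝ} {p q C : ℝ} {Q : ℝ → ℝ → ℝ}

theorem integral_comp_add_mul (F G : E → ℝ) (s : E) :
    ∫ x, F (x + s) * G x ∂μ = ∫ x, F x * G (x - s) ∂μ := by
  rw [← integral_add_right_eq_self (fun x => F x * G (x - s)) s]
  simp

theorem integral_comp_sub_mul (F G : E → ℝ) (s : E) :
    ∫ x, F (x - s) * G x ∂μ = ∫ x, F x * G (x + s) ∂μ := by
  simpa only [sub_eq_add_neg, neg_neg] using integral_comp_add_mul (μ := μ) F G (-s)

variable [IsFiniteMeasureOnCompacts μ]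

theorem integral_symAvg_mul (hF : IsCc F) (hG : IsCc G) (s : E) :
    ∫ x, symAvg s F x * G x ∂μ = ∫ x, F x * symAvg s G x ∂μ := by
  have h1 : ∀ x, symAvg s F x * G x = (F (x + s) * G x + F (x - s) * G x) / 2 := fun x => by
    rw [symAvg_apply]; ring
  have h2 : ∀ x, F x * symAvg s G x = (F x * G (x + s) + F x * G (x - s)) / 2 := fun x => by
    rw [symAvg_apply]; ring
  simp_rw [h1, h2, integral_div]
  rw [integral_add ((hF.comp_add s).mul hG).integrable ((hF.comp_sub s).mul hG).integrable,
    integral_add (hF.mul (hG.comp_add s)).integrable (hF.mul (hG.comp_sub s)).integrable,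
    integral_comp_add_mul, integral_comp_sub_mul, add_comm]

theorem integral_centralDiff_mul (hF : IsCc F) (hG : IsCc G) (s : E) :
    ∫ x, centralDiff s F x * G x ∂μ = -∫ x, F x * centralDiff s G x ∂μ := by
  have h1 : ∀ x, centralDiff s F x * G x = F (x + s) * G x - F (x - s) * G x := fun x => by
    rw [centralDiff_apply]; ring
  have h2 : ∀ x, F x * centralDiff s G x = F x * G (x + s) - F x * G (x - s) := fun x => by
    rw [centralDiff_apply]; ring
  simp_rw [h1, h2]
  rw [integral_sub ((hF.comp_add s).mul hG).integrable ((hF.comp_sub s).mul hG).integrable,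
    integral_sub (hF.mul (hG.comp_add s)).integrable (hF.mul (hG.comp_sub s)).integrable,
    integral_comp_add_mul, integral_comp_sub_mul, neg_sub]

theorem integral_iterAvg_mul (hF : IsCc F) (hG : IsCc G) (L : List E) :
    ∫ x, iterAvg L F x * G x ∂μ = ∫ x, F x * iterAvg L G x ∂μ := by
  induction L generalizing G with
  | nil => rfl
  | cons t L ih =>
    rw [iterAvg_cons, integral_symAvg_mul (hF.iterAvg L) hG, ih (hG.symAvg t), iterAvg_cons]
    rw [← Module.End.mul_apply, ← Module.End.mul_apply, (commute_symAvg_iterAvg t L).eq]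

theorem IsBellman.zero (hQ : IsBellman p q C Q) (hp : 0 < p) (hq : 0 < q) : Q 0 0 = 0 :=
  le_antisymm (by simpa [zero_rpow hp.ne', zero_rpow hq.ne'] using hQ.2.2.1 0 0) (hQ.2.1 0 0)

theorem integral_bellman_symAvg_le (hQ : IsBellman p q C Q) (hp : 0 < p) (hq : 0 < q)
    (hF : IsCc F) (hG : IsCc G) (s : E) :
    ∫ x, Q (symAvg s F x) (symAvg s G x) ∂μ
      + 1 / 8 * ∫ x, |centralDiff s F x| * |centralDiff s G x| ∂μ ≤ ∫ x, Q (F x) (G x) ∂μ := by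
  have h0 := hQ.zero hp hq
  have hQFG := IsCc.comp₂ hQ.1 h0 hF hG
  have hD : IsCc fun x => |centralDiff s F x| * |centralDiff s G x| :=
    IsCc.comp₂ (m := fun a b => |a| * |b|) (by fun_prop) (by simp)
      (hF.centralDiff s) (hG.centralDiff s)
  have hA := IsCc.comp₂ hQ.1 h0 (hF.symAvg s) (hG.symAvg s)
  have h2 : ∫ x, Q (F (x + s)) (G (x + s)) + Q (F (x - s)) (G (x - s)) ∂μ =
      2 * ∫ x, Q (F x) (G x) ∂μ := by
    rw [integral_add (hQFG.comp_add s).integrable (hQFG.comp_sub s).integrable,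
      integral_add_right_eq_self (fun x => Q (F x) (G x)) s,
      integral_sub_right_eq_self (fun x => Q (F x) (G x)) s, two_mul]
  have h3 : ∫ x, 2 * Q (symAvg s F x) (symAvg s G x) +
      1 / 4 * (|centralDiff s F x| * |centralDiff s G x|) ∂μ ≤
      ∫ x, Q (F (x + s)) (G (x + s)) + Q (F (x - s)) (G (x - s)) ∂μ := by
    refine integral_mono ((hA.integrable.const_mul _).add (hD.integrable.const_mul _))
      ((hQFG.comp_add s).integrable.add (hQFG.comp_sub s).integrable) fun x => ?_
    have := hQ.2.2.2 (symAvg s F x) (symAvg s G x) (centralDiff s F x / 2) (centralDiff s G x / 2)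
    have e : ∀ H : E → ℝ, symAvg s H x + centralDiff s H x / 2 = H (x + s) ∧
        symAvg s H x - centralDiff s H x / 2 = H (x - s) := fun H => by
      rw [symAvg_apply, centralDiff_apply]; constructor <;> ring
    rw [(e F).1, (e F).2, (e G).1, (e G).2, abs_div, abs_div, abs_two] at this
    dsimp only
    linarith
  rw [integral_add (hA.integrable.const_mul _) (hD.integrable.const_mul _), integral_const_mul,
    integral_const_mul, h2] at h3
  linarith

theorem integral_bellman_iterAvg_le_self (hQ : IsBellman p q C Q) (hp : 0 < p) (hq : 0 < q)
    (hF : IsCc F) (hG : IsCc G) (L : List E) :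
    ∫ x, Q (iterAvg L F x) (iterAvg L G x) ∂μ ≤ ∫ x, Q (F x) (G x) ∂μ := by
  induction L with
  | nil => rfl
  | cons t L ih =>
    refine le_trans ?_ ih
    have := integral_bellman_symAvg_le (μ := μ) hQ hp hq (hF.iterAvg L) (hG.iterAvg L) t
    have h0 : 0 ≤ ∫ x, |centralDiff t (iterAvg L F) x| * |centralDiff t (iterAvg L G) x| ∂μ :=
      integral_nonneg fun x => by positivity
    simp only [iterAvg_cons]
    linarith

theorem integral_bellman_iterAvg_le (hQ : IsBellman p q C Q) (hp : 0 < p) (hq : 0 < q)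
    (hF : IsCc F) (hG : IsCc G) {L : List E} {s : E} (hs : s ∈ L) :
    ∫ x, Q (iterAvg L F x) (iterAvg L G x) ∂μ
      + 1 / 8 * ∫ x, |centralDiff s F x| * |centralDiff s G x| ∂μ ≤ ∫ x, Q (F x) (G x) ∂μ := by
  induction L with
  | nil => simp at hs
  | cons t L ih =>
    rcases List.mem_cons.1 hs with rfl | hs
    · refine le_trans ?_ (integral_bellman_symAvg_le (μ := μ) hQ hp hq hF hG s)
      have h := integral_bellman_iterAvg_le_self (μ := μ) hQ hp hq (hF.symAvg s) (hG.symAvg s) L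
      have e : ∀ H : E → ℝ, iterAvg (s :: L) H = iterAvg L (symAvg s H) := fun H =>
        LinearMap.congr_fun (commute_symAvg_iterAvg s L).eq H
      rw [e, e]
      linarith
    · refine le_trans ?_ (ih hs)
      have := integral_bellman_symAvg_le (μ := μ) hQ hp hq (hF.iterAvg L) (hG.iterAvg L) t
      have h0 : 0 ≤ ∫ x, |centralDiff t (iterAvg L F) x| * |centralDiff t (iterAvg L G) x| ∂μ :=
        integral_nonneg fun x => by positivity
      simp only [iterAvg_cons]
      linarith

/-- The bilinear estimate for the central differences along the averaging iteration. -/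
theorem sum_integral_abs_centralDiff_mul_le (hQ : IsBellman p q C Q) (hp : 0 < p) (hq : 0 < q)
    (hF : IsCc F) (hG : IsCc G) {L : List E} {s : E} (hs : s ∈ L) (M : ℕ) :
    ∑ k ∈ Finset.range M, ∫ x, |centralDiff s ((iterAvg L ^ k) F) x| *
      |centralDiff s ((iterAvg L ^ k) G) x| ∂μ ≤ 8 * ∫ x, Q (F x) (G x) ∂μ := by
  have key : ∫ x, Q ((iterAvg L ^ M) F x) ((iterAvg L ^ M) G x) ∂μ + 1 / 8 *
      ∑ k ∈ Finset.range M, ∫ x, |centralDiff s ((iterAvg L ^ k) F) x| *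
        |centralDiff s ((iterAvg L ^ k) G) x| ∂μ ≤ ∫ x, Q (F x) (G x) ∂μ := by
    induction M with
    | zero => simp
    | succ M ih =>
      have := integral_bellman_iterAvg_le (μ := μ) hQ hp hq (hF.iterAvg_pow L M)
        (hG.iterAvg_pow L M) hs
      rw [Finset.sum_range_succ, pow_succ', Module.End.mul_apply, Module.End.mul_apply]
      linarith
  have h0 : 0 ≤ ∫ x, Q ((iterAvg L ^ M) F x) ((iterAvg L ^ M) G x) ∂μ :=
    integral_nonneg fun x => hQ.2.1 _ _
  linarith

theorem integral_abs_iterAvg_rpow_le (hq : 1 ≤ q) (hG : IsCc G) (L : List E) :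
    ∫ x, |iterAvg L G x| ^ q ∂μ ≤ ∫ x, |G x| ^ q ∂μ := by
  induction L with
  | nil => rfl
  | cons t L ih =>
    refine le_trans ?_ ih
    rw [iterAvg_cons]
    have hH := hG.iterAvg L
    generalize iterAvg L G = H at *
    have hHq := hH.abs_rpow (by linarith : 0 < q)
    calc ∫ x, |symAvg t H x| ^ q ∂μ ≤
        ∫ x, (1 / 2 * |H (x + t)| ^ q + 1 / 2 * |H (x - t)| ^ q) ∂μ := by
          refine integral_mono ((hH.symAvg t).abs_rpow (by linarith)).integrable
            (((hHq.comp_add t).integrable.const_mul _).add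
              ((hHq.comp_sub t).integrable.const_mul _)) fun x => ?_
          have hc : (1 / 2 * |H (x + t)| + 1 / 2 * |H (x - t)|) ^ q ≤
              1 / 2 * |H (x + t)| ^ q + 1 / 2 * |H (x - t)| ^ q :=
            (convexOn_rpow hq).2 (abs_nonneg (H (x + t))) (abs_nonneg (H (x - t)))
              (by norm_num) (by norm_num) (by norm_num)
          refine le_trans (rpow_le_rpow (abs_nonneg _) ?_ (by linarith)) hc
          rw [symAvg_apply, abs_div, abs_two]
          linarith [abs_add_le (H (x + t)) (H (x - t))]
      _ = ∫ x, |H x| ^ q ∂μ := by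
          rw [integral_add ((hHq.comp_add t).integrable.const_mul _)
            ((hHq.comp_sub t).integrable.const_mul _), integral_const_mul, integral_const_mul,
            integral_add_right_eq_self (fun x => |H x| ^ q) t,
            integral_sub_right_eq_self (fun x => |H x| ^ q) t]
          ring

end DiscreteEstimate

section DiscreteMain

variable {E : Type*} [NormedAddCommGroup E] [MeasurableSpace E] [BorelSpace E] {μ : Measure E}
  [μ.IsAddRightInvariant] [IsFiniteMeasureOnCompacts μ]
  {F G u : E → ℝ} {p q C : ℝ} {Q : ℝ → ℝ → ℝ}

theorem integral_centralDiff_iterAvg_pow_succ (hF : IsCc F) (hG : IsCc G) (L : List E) (s : E)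
    (k : ℕ) :
    ∫ x, centralDiff s ((iterAvg L ^ (k + 1)) F) x * centralDiff s ((iterAvg L ^ (k + 1)) G) x ∂μ =
      ∫ x, centralDiff s ((iterAvg L ^ k) F) x * centralDiff s ((iterAvg L ^ k) G) x ∂μ
      + ∫ x, centralDiff s ((iterAvg L ^ k) (iterAvg L F - F)) x *
          centralDiff s ((iterAvg L ^ k) G) x ∂μ
      + ∫ x, centralDiff s ((iterAvg L ^ k) (iterAvg L F - F)) x *
          centralDiff s ((iterAvg L ^ k) (iterAvg L G)) x ∂μ := by
  have hb : ∀ {H K : E → ℝ}, IsCc H → IsCc K → Integrable (fun x =>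
      centralDiff s ((iterAvg L ^ k) H) x * centralDiff s ((iterAvg L ^ k) K) x) μ :=
    fun hH hK => (((hH.iterAvg_pow L k).centralDiff s).mul
      ((hK.iterAvg_pow L k).centralDiff s)).integrable
  have hsub : ∀ {K : E → ℝ}, IsCc K →
      ∫ x, centralDiff s ((iterAvg L ^ k) (iterAvg L F - F)) x *
        centralDiff s ((iterAvg L ^ k) K) x ∂μ =
      ∫ x, centralDiff s ((iterAvg L ^ k) (iterAvg L F)) x *
        centralDiff s ((iterAvg L ^ k) K) x ∂μ -
      ∫ x, centralDiff s ((iterAvg L ^ k) F) x * centralDiff s ((iterAvg L ^ k) K) x ∂μ := by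
    intro K hK
    rw [← integral_sub (hb (hF.iterAvg L) hK) (hb hF hK)]
    simp only [map_sub, Pi.sub_apply, sub_mul]
  have hswap : ∀ H : E → ℝ, centralDiff s ((iterAvg L ^ k) (iterAvg L H)) =
      iterAvg L (centralDiff s ((iterAvg L ^ k) H)) := by
    intro H
    change centralDiff s ((iterAvg L ^ k * iterAvg L) H) = _
    rw [← pow_succ, pow_succ', Module.End.mul_apply]
    exact LinearMap.congr_fun (commute_centralDiff_iterAvg s L).eq _
  have hadj : ∫ x, centralDiff s ((iterAvg L ^ k) (iterAvg L F)) x *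
        centralDiff s ((iterAvg L ^ k) G) x ∂μ =
      ∫ x, centralDiff s ((iterAvg L ^ k) F) x *
        centralDiff s ((iterAvg L ^ k) (iterAvg L G)) x ∂μ := by
    rw [hswap, hswap]
    exact integral_iterAvg_mul ((hF.iterAvg_pow L k).centralDiff s)
      ((hG.iterAvg_pow L k).centralDiff s) L
  rw [hsub hG, hsub (hG.iterAvg L), hadj, pow_succ, Module.End.mul_apply, Module.End.mul_apply]
  ring

theorem abs_integral_centralDiff_mul_le (hpq : p.HolderConjugate q) (hQ : IsBellman p q C Q)
    (hC : 0 < C) (hu : IsCc u) (hG : IsCc G) {L : List E} {s : E} (hs : s ∈ L) :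
    |∫ x, centralDiff s u x * centralDiff s G x ∂μ| ≤
      16 * C * (∫ x, |iterAvg L u x - u x| ^ p ∂μ + ∫ x, |G x| ^ q ∂μ) := by
  have hp := hpq.pos
  have hq := hpq.symm.pos
  set b : ℕ → (E → ℝ) → (E → ℝ) → ℝ := fun k F G =>
    ∫ x, centralDiff s ((iterAvg L ^ k) F) x * centralDiff s ((iterAvg L ^ k) G) x ∂μ with hb
  set a : ℕ → (E → ℝ) → (E → ℝ) → ℝ := fun k F G =>
    ∫ x, |centralDiff s ((iterAvg L ^ k) F) x| * |centralDiff s ((iterAvg L ^ k) G) x| ∂μ with ha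
  have hba : ∀ k F G, |b k F G| ≤ a k F G := by
    intro k F G
    simp only [hb, ha, ← abs_mul]
    exact abs_integral_le_integral_abs
  have hsum : ∀ {F G : E → ℝ}, IsCc F → IsCc G → ∀ M, ∑ k ∈ Finset.range M, a k F G ≤
      8 * ∫ x, Q (F x) (G x) ∂μ := fun hF hG M =>
    sum_integral_abs_centralDiff_mul_le hQ hp hq hF hG hs M
  have ha0 : ∀ k F G, 0 ≤ a k F G := fun k F G => integral_nonneg fun x => by positivity
  have hf : IsCc (iterAvg L u - u) := (hu.iterAvg L).sub hu
  have hQle : ∀ {G : E → ℝ}, IsCc G → ∫ x, Q ((iterAvg L u - u) x) (G x) ∂μ ≤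
      C * (∫ x, |iterAvg L u x - u x| ^ p ∂μ + ∫ x, |G x| ^ q ∂μ) := by
    intro G hG
    have hfp : Integrable (fun x => |iterAvg L u x - u x| ^ p) μ := (hf.abs_rpow hp).integrable
    rw [← integral_add hfp (hG.abs_rpow hq).integrable, ← integral_const_mul]
    exact integral_mono (IsCc.comp₂ hQ.1 (hQ.zero hp hq) hf hG).integrable
      ((hfp.add (hG.abs_rpow hq).integrable).const_mul C)
      fun x => hQ.2.2.1 _ _
  have htel : ∀ M, b M u G = b 0 u G + ∑ k ∈ Finset.range M,
      (b k (iterAvg L u - u) G + b k (iterAvg L u - u) (iterAvg L G)) := by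
    intro M
    induction M with
    | zero => simp
    | succ M ih =>
      rw [Finset.sum_range_succ, ← add_assoc, ← ih]
      simp only [hb]
      rw [integral_centralDiff_iterAvg_pow_succ hu hG L s M, add_assoc]
  have hbound : ∀ M, |b 0 u G| ≤ a M u G +
      16 * C * (∫ x, |iterAvg L u x - u x| ^ p ∂μ + ∫ x, |G x| ^ q ∂μ) := by
    intro M
    have h1 : b 0 u G = b M u G - ∑ k ∈ Finset.range M,
      (b k (iterAvg L u - u) G + b k (iterAvg L u - u) (iterAvg L G)) := by rw [htel M]; ring
    have h2 : |∑ k ∈ Finset.range M,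
        (b k (iterAvg L u - u) G + b k (iterAvg L u - u) (iterAvg L G))| ≤
        8 * ∫ x, Q ((iterAvg L u - u) x) (G x) ∂μ
        + 8 * ∫ x, Q ((iterAvg L u - u) x) (iterAvg L G x) ∂μ := by
      refine (Finset.abs_sum_le_sum_abs _ _).trans (le_trans ?_
        (add_le_add (hsum hf hG M) (hsum hf (hG.iterAvg L) M)))
      rw [← Finset.sum_add_distrib]
      exact Finset.sum_le_sum fun k _ => (abs_add_le _ _).trans (add_le_add (hba _ _ _) (hba _ _ _))
    have h3 := hQle hG
    have h4 := hQle (hG.iterAvg L)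
    have h5 := mul_le_mul_of_nonneg_left
      (integral_abs_iterAvg_rpow_le (μ := μ) hpq.symm.lt.le hG L) hC.le
    have h6 := hba M u G
    have h7 := abs_sub (b M u G) (∑ k ∈ Finset.range M,
      (b k (iterAvg L u - u) G + b k (iterAvg L u - u) (iterAvg L G)))
    rw [← h1] at h7
    linarith
  have hlim : Filter.Tendsto (fun M => a M u G) Filter.atTop (nhds 0) :=
    (summable_of_sum_range_le (fun k => ha0 k u G) (hsum hu hG)).tendsto_atTop_zero
  have := ge_of_tendsto' (hlim.add_const _) hbound
  rwa [zero_add] at this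

theorem exists_dual_function (hpq : p.HolderConjugate q) :
    ∃ φ : ℝ → ℝ, Continuous φ ∧ φ 0 = 0 ∧ (∀ t, t * φ t = |t| ^ p) ∧ ∀ t, |φ t| ^ q = |t| ^ p := by
  have h1 : 0 < p - 1 := hpq.sub_one_pos
  refine ⟨fun t => max t 0 ^ (p - 1) - max (-t) 0 ^ (p - 1), ?_, ?_, fun t => ?_, fun t => ?_⟩
  · exact ((continuous_id.max continuous_const).rpow_const fun _ => Or.inr h1.le).sub
      ((continuous_neg.max continuous_const).rpow_const fun _ => Or.inr h1.le)
  · simp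
  all_goals
    have hz : (0 : ℝ) ^ (p - 1) = 0 := zero_rpow h1.ne'
    have hmul : ∀ t : ℝ, 0 ≤ t → t * t ^ (p - 1) = t ^ p := fun t ht => by
      conv_lhs => rw [← rpow_one_add' ht (by linarith [hpq.pos])]
      congr 1; ring
    have hpow : ∀ t : ℝ, 0 ≤ t → (t ^ (p - 1)) ^ q = t ^ p := fun t ht => by
      rw [← rpow_mul ht, hpq.sub_one_mul_conj]
    rcases le_total 0 t with ht | ht
    · simp only [max_eq_left ht, max_eq_right (neg_nonpos.2 ht), hz, sub_zero, abs_of_nonneg ht,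
        abs_of_nonneg (rpow_nonneg ht _), hmul t ht, hpow t ht]
    · have ht' := neg_nonneg.2 ht
      simp only [max_eq_right ht, max_eq_left ht', hz, zero_sub, abs_of_nonpos ht, abs_neg,
        abs_of_nonneg (rpow_nonneg ht' _), hpow _ ht', ← hmul _ ht']
      try ring

theorem exists_integral_centralDiff_le (hp : 1 < p) : ∃ C : ℝ, 0 < C ∧
    ∀ (L : List E) (s : E), s ∈ L → ∀ u : E → ℝ, IsCc u →
      ∫ x, |centralDiff s (centralDiff s u) x| ^ p ∂μ ≤ C * ∫ x, |iterAvg L u x - u x| ^ p ∂μ := by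
  have hpq := Real.HolderConjugate.conjExponent hp
  set q := p.conjExponent
  obtain ⟨C, hC, Q, hQ⟩ := exists_isBellman hpq
  obtain ⟨φ, hφ, hφ0, hφ1, hφ2⟩ := exists_dual_function hpq
  set A := 32 * C with hA
  have hA0 : 0 < A := by positivity
  set r := (1 / A) ^ (p - 1) with hr
  have hr0 : 0 < r := by positivity
  refine ⟨A / r, by positivity, fun L s hs u hu => ?_⟩
  set v := centralDiff s (centralDiff s u)
  have hv : IsCc v := (hu.centralDiff s).centralDiff s
  have hG : IsCc fun x => r * φ (v x) :=
    hv.comp_left (m := fun t => r * φ t) (by fun_prop) (by simp [hφ0])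
  have key := abs_integral_centralDiff_mul_le (μ := μ) hpq hQ hC hu hG hs
  have e1 : ∫ x, centralDiff s u x * centralDiff s (fun x => r * φ (v x)) x ∂μ =
      -(r * ∫ x, |v x| ^ p ∂μ) := by
    rw [← neg_eq_iff_eq_neg, ← integral_centralDiff_mul (hu.centralDiff s) hG,
      ← integral_const_mul]
    refine integral_congr_ae (.of_forall fun x => ?_)
    change v x * (r * φ (v x)) = r * |v x| ^ p
    rw [← hφ1]; ring
  have e2 : ∫ x, |r * φ (v x)| ^ q ∂μ = r ^ q * ∫ x, |v x| ^ p ∂μ := by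
    rw [← integral_const_mul]
    refine integral_congr_ae (.of_forall fun x => ?_)
    change |r * φ (v x)| ^ q = _
    rw [abs_mul, mul_rpow (abs_nonneg _) (abs_nonneg _), hφ2, abs_of_pos hr0]
  have e3 : A * r ^ q = r := by
    have : r ^ q = (1 / A) ^ p := by
      rw [hr, ← rpow_mul (by positivity), hpq.sub_one_mul_conj]
    rw [this, hr]
    have := rpow_sub_one (x := 1 / A) (by positivity) p
    rw [this]; field_simp
  have hI : 0 ≤ ∫ x, |v x| ^ p ∂μ := integral_nonneg fun x => by positivity
  rw [e1, e2, abs_neg, abs_of_nonneg (by positivity)] at key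
  have e4 : 16 * C * (r ^ q * ∫ x, |v x| ^ p ∂μ) = r / 2 * ∫ x, |v x| ^ p ∂μ := by
    calc _ = (A * r ^ q) / 2 * ∫ x, |v x| ^ p ∂μ := by rw [hA]; ring
      _ = _ := by rw [e3]
  rw [mul_add, e4] at key
  rw [div_mul_eq_mul_div, le_div_iff₀ hr0]
  rw [hA]
  linarith

end DiscreteMain

section Auxiliary

variable {E : Type*} [NormedAddCommGroup E]

theorem abs_symAvg_le {F : E → ℝ} {B : ℝ} (hF : ∀ x, |F x| ≤ B) (s x : E) : |symAvg s F x| ≤ B := by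
  have h1 := hF (x + s)
  have h2 := hF (x - s)
  rw [symAvg_apply]
  rw [abs_le] at *
  constructor <;> linarith

variable [MeasurableSpace E] [BorelSpace E] {μ : Measure E} [IsFiniteMeasureOnCompacts μ]

theorem tendsto_integral_abs_rpow [ProperSpace E] {p C R : ℝ} (hp : 0 < p)
    {f : ℕ → E → ℝ} {g : E → ℝ}
    (hf : ∀ k, Continuous (f k)) (hg : IsCc g)
    (hfg : ∀ k x, |f k x - g x| ≤ C * (1 / ((k : ℝ) + 1)))
    (hR : ∀ k x, R < ‖x‖ → f k x = 0) :
    Filter.Tendsto (fun k => ∫ x, |f k x| ^ p ∂μ) Filter.atTop (nhds (∫ x, |g x| ^ p ∂μ)) := by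
  obtain ⟨B, hB⟩ := hg.2.exists_bound_of_continuous hg.1
  have hC : 0 ≤ C := by
    have := (abs_nonneg _).trans (hfg 0 0)
    simpa using this
  refine tendsto_integral_of_dominated_convergence
    ((Metric.closedBall (0 : E) R).indicator fun _ => (B + C) ^ p) (fun k => ?_) ?_ (fun k => ?_) ?_
  · exact ((hf k).abs.rpow_const fun _ => Or.inr hp.le).aestronglyMeasurable
  · refine (integrable_indicator_iff Metric.isClosed_closedBall.measurableSet).2 ?_
    exact continuousOn_const.integrableOn_compact (isCompact_closedBall _ _)
  · refine .of_forall fun x => ?_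
    by_cases hx : x ∈ Metric.closedBall (0 : E) R
    · rw [Set.indicator_of_mem hx, Real.norm_eq_abs, abs_of_nonneg (by positivity)]
      refine rpow_le_rpow (abs_nonneg _) ?_ hp.le
      have h1 := hfg k x
      have h2 : |g x| ≤ B := hB x
      have h3 : C * (1 / ((k : ℝ) + 1)) ≤ C * 1 := by
        gcongr
        rw [div_le_one (by positivity)]
        linarith [(Nat.cast_nonneg k : (0 : ℝ) ≤ k)]
      rw [abs_le] at *
      constructor <;> linarith
    · rw [mem_closedBall_zero_iff, not_le] at hx
      rw [hR k x hx, abs_zero, zero_rpow hp.ne', norm_zero]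
      refine Set.indicator_nonneg (fun y _ => ?_) x
      exact rpow_nonneg (add_nonneg ((norm_nonneg _).trans (hB 0)) hC) _
  · refine .of_forall fun x => ?_
    have h1 : Filter.Tendsto (fun k => f k x) Filter.atTop (nhds (g x)) := by
      rw [tendsto_iff_norm_sub_tendsto_zero]
      refine squeeze_zero (fun k => norm_nonneg _) (fun k => hfg k x) ?_
      simpa using (tendsto_one_div_add_atTop_nhds_zero_nat (𝕜 := ℝ)).const_mul C
    exact h1.abs.rpow_const (Or.inr hp.le)

end Auxiliary

section TestFunctions

variable {E : Type*} [NormedAddCommGroup E] [NormedSpace ℝ E]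

/-- Directional derivative as an operator on functions. -/
noncomputable def dirDeriv (v : E) (u : E → ℝ) : E → ℝ := fun x => fderiv ℝ u x v

/-- Smooth functions with compact support. -/
def IsTest (u : E → ℝ) : Prop := ContDiff ℝ (⊤ : ℕ∞) u ∧ HasCompactSupport u

namespace IsTest

variable {u w : E → ℝ}

theorem differentiable (hu : IsTest u) : Differentiable ℝ u := hu.1.differentiable (by simp)

theorem isCc (hu : IsTest u) : IsCc u := ⟨hu.1.continuous, hu.2⟩

theorem dirDeriv (hu : IsTest u) (v : E) : IsTest (dirDeriv v u) :=
  ⟨(hu.1.fderiv_right (m := (⊤ : ℕ∞)) (by simp)).clm_apply contDiff_const, hu.2.fderiv_apply ℝ v⟩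

theorem add (hu : IsTest u) (hw : IsTest w) : IsTest fun x => u x + w x :=
  ⟨hu.1.add hw.1, HasCompactSupport.add hu.2 hw.2⟩

theorem zero : IsTest fun _ : E => (0 : ℝ) := ⟨contDiff_const, HasCompactSupport.zero⟩

theorem sum {ι : Type*} {s : Finset ι} {f : ι → E → ℝ} (hf : ∀ i ∈ s, IsTest (f i)) :
    IsTest fun x => ∑ i ∈ s, f i x := by
  classical
  induction s using Finset.induction_on with
  | empty => simpa using zero
  | insert a s ha ih =>
    simp only [Finset.sum_insert ha]
    exact (hf a (by simp)).add (ih fun i hi => hf i (by simp [hi]))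

theorem listSum {ι : Type*} (L : List ι) {f : ι → E → ℝ} (hf : ∀ i, IsTest (f i)) :
    IsTest fun x => (L.map fun i => f i x).sum := by
  induction L with
  | nil => simpa using zero
  | cons a L ih => simpa using (hf a).add ih

theorem exists_lipschitz (hu : IsTest u) : ∃ K : ℝ, 0 ≤ K ∧ ∀ x y, |u x - u y| ≤ K * ‖x - y‖ := by
  obtain ⟨K, hK⟩ := (hu.1.of_le (by simp : (1 : WithTop ℕ∞) ≤ _)).lipschitzWith_of_hasCompactSupport
    hu.2 (by simp)
  exact ⟨K, K.2, fun x y => by simpa [Real.norm_eq_abs] using hK.norm_sub_le x y⟩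

theorem exists_radius (hu : IsTest u) : ∃ R : ℝ, 0 ≤ R ∧ ∀ x, R < ‖x‖ → u x = 0 := by
  obtain ⟨R, hR⟩ := hu.2.isBounded.subset_closedBall (0 : E)
  refine ⟨max R 0, le_max_right _ _, fun x hx => ?_⟩
  by_contra h
  have := hR (subset_tsupport u h)
  rw [mem_closedBall_zero_iff] at this
  exact absurd hx (not_lt.2 (this.trans (le_max_left _ _)))

theorem hasDerivAt_line (hu : IsTest u) (x s : E) (t : ℝ) :
    HasDerivAt (fun t : ℝ => u (x + t • s)) (_root_.dirDeriv s u (x + t • s)) t := by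
  have h1 : HasDerivAt (fun t : ℝ => x + t • s) s t := by
    simpa using ((hasDerivAt_id t).smul_const s).const_add x
  exact (hu.differentiable (x + t • s)).hasFDerivAt.comp_hasDerivAt t h1

end IsTest

variable {u w : E → ℝ}

theorem dirDeriv_comm (hu : ContDiff ℝ (⊤ : ℕ∞) u) (v w : E) :
    dirDeriv v (dirDeriv w u) = dirDeriv w (dirDeriv v u) := by
  have h : ∀ a b : E, ∀ x, dirDeriv a (dirDeriv b u) x = fderiv ℝ (fderiv ℝ u) x a b := by
    intro a b x
    have hd : DifferentiableAt ℝ (fderiv ℝ u) x :=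
      (hu.fderiv_right (m := (⊤ : ℕ∞)) (by simp)).differentiable (by simp) x
    change fderiv ℝ (fun y => fderiv ℝ u y b) x a = _
    rw [fderiv_clm_apply hd (differentiableAt_const b)]
    simp
  ext x
  rw [h, h]
  exact (hu.contDiffAt (x := x)).isSymmSndFDerivAt
    (by simpa using WithTop.coe_le_coe.2 (le_top : (2 : ℕ∞) ≤ ⊤)) v w

theorem dirDeriv_add_left (v w : E) (u : E → ℝ) (x : E) :
    dirDeriv (v + w) u x = dirDeriv v u x + dirDeriv w u x := map_add _ _ _

theorem dirDeriv_smul_left (c : ℝ) (v : E) (u : E → ℝ) (x : E) :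
    dirDeriv (c • v) u x = c * dirDeriv v u x := map_smul _ _ _

theorem dirDeriv_add (v : E) {u w : E → ℝ} (hu : Differentiable ℝ u) (hw : Differentiable ℝ w) :
    dirDeriv v (fun x => u x + w x) = fun x => dirDeriv v u x + dirDeriv v w x := by
  ext x
  simp only [dirDeriv, fderiv_fun_add (hu x) (hw x), _root_.add_apply]

theorem dirDeriv_const_mul (v : E) (c : ℝ) {u : E → ℝ} (hu : Differentiable ℝ u) :
    dirDeriv v (fun x => c * u x) = fun x => c * dirDeriv v u x := by
  ext x
  simp only [dirDeriv, fderiv_const_mul (hu x), _root_.smul_apply, smul_eq_mul]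

/-- Second order Taylor estimate for symmetric averages. -/
theorem exists_symAvg_sub_le (hu : IsTest u) (s : E) : ∃ C : ℝ, 0 ≤ C ∧
    ∀ h : ℝ, 0 < h → ∀ x,
      |symAvg (h • s) u x - u x - h ^ 2 / 2 * dirDeriv s (dirDeriv s u) x| ≤ C * h ^ 3 := by
  set us := dirDeriv s u with hus_def
  set uss := dirDeriv s us with huss_def
  have hus : IsTest us := hu.dirDeriv s
  have huss : IsTest uss := hus.dirDeriv s
  obtain ⟨K, hK0, hK⟩ := huss.exists_lipschitz
  refine ⟨K * ‖s‖, by positivity, fun h hh x => ?_⟩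
  have d : ∀ {w : E → ℝ}, IsTest w → ∀ t : ℝ, HasDerivAt (fun t : ℝ => w (x - t • s))
      (-dirDeriv s w (x - t • s)) t := by
    intro w hw t
    have := hw.hasDerivAt_line x (-s) t
    simpa [sub_eq_add_neg, dirDeriv] using this
  have hψ : ∀ t : ℝ, HasDerivAt
      (fun t => (u (x + t • s) + u (x - t • s)) / 2 - u x - t ^ 2 / 2 * uss x)
      ((us (x + t • s) - us (x - t • s)) / 2 - t * uss x) t := fun t => by
    have := ((((hu.hasDerivAt_line x s t).add (d hu t)).div_const 2).sub_const (u x)).sub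
      ((((hasDerivAt_id t).pow 2).div_const 2).mul_const (uss x))
    refine this.congr_deriv ?_
    simp; ring
  have hψ' : ∀ t : ℝ, HasDerivAt
      (fun t => (us (x + t • s) - us (x - t • s)) / 2 - t * uss x)
      ((uss (x + t • s) + uss (x - t • s)) / 2 - uss x) t := fun t => by
    have := (((hus.hasDerivAt_line x s t).sub (d hus t)).div_const 2).sub
      ((hasDerivAt_id t).mul_const (uss x))
    refine this.congr_deriv ?_
    simp; ring
  have b2 : ∀ t ∈ Set.Icc (0 : ℝ) h, |(uss (x + t • s) + uss (x - t • s)) / 2 - uss x| ≤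
      K * ‖s‖ * h := by
    intro t ht
    have h1 := hK (x + t • s) x
    have h2 := hK (x - t • s) x
    rw [add_sub_cancel_left, norm_smul, Real.norm_eq_abs, abs_of_nonneg ht.1] at h1
    rw [sub_sub_cancel_left, norm_neg, norm_smul, Real.norm_eq_abs, abs_of_nonneg ht.1] at h2
    have h3 : K * (t * ‖s‖) ≤ K * ‖s‖ * h := by
      have : K * ‖s‖ * t ≤ K * ‖s‖ * h := by gcongr; exact ht.2
      linarith
    rw [abs_le] at *
    constructor <;> linarith
  have b1 : ∀ t ∈ Set.Icc (0 : ℝ) h, |(us (x + t • s) - us (x - t • s)) / 2 - t * uss x| ≤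
      K * ‖s‖ * h * h := by
    intro t ht
    have := norm_image_sub_le_of_norm_deriv_le_segment' (a := 0) (b := h)
      (fun t _ => (hψ' t).hasDerivWithinAt) (fun t ht => b2 t ⟨ht.1, ht.2.le⟩) t ht
    simp only [zero_smul, add_zero, sub_zero, sub_self, zero_div, zero_mul,
      Real.norm_eq_abs] at this
    refine this.trans ?_
    gcongr
    exact ht.2
  have := norm_image_sub_le_of_norm_deriv_le_segment' (a := 0) (b := h)
      (fun t _ => (hψ t).hasDerivWithinAt) (fun t ht => b1 t ⟨ht.1, ht.2.le⟩) h ⟨hh.le, le_rfl⟩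
  simp only [zero_smul, add_zero, sub_zero, add_self_div_two, ne_eq, OfNat.ofNat_ne_zero,
    not_false_eq_true, zero_pow, zero_div, zero_mul, sub_self, Real.norm_eq_abs] at this
  rw [symAvg_apply]
  refine this.trans (le_of_eq ?_)
  ring

theorem exists_symAvg_sub_self_le (hu : IsTest u) (s : E) : ∃ C : ℝ, 0 ≤ C ∧
    ∀ h : ℝ, 0 < h → ∀ x, |symAvg (h • s) u x - u x| ≤ C * h := by
  obtain ⟨K, hK0, hK⟩ := hu.exists_lipschitz
  refine ⟨K * ‖s‖, by positivity, fun h hh x => ?_⟩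
  have h1 := hK (x + h • s) x
  have h2 := hK (x - h • s) x
  rw [add_sub_cancel_left, norm_smul, Real.norm_eq_abs, abs_of_pos hh] at h1
  rw [sub_sub_cancel_left, norm_neg, norm_smul, Real.norm_eq_abs, abs_of_pos hh] at h2
  rw [symAvg_apply]
  rw [abs_le] at *
  constructor <;> linarith

theorem exists_iterAvg_sub_le (hu : IsTest u) (L : List E) : ∃ C : ℝ, 0 ≤ C ∧
    ∀ h : ℝ, 0 < h → ∀ x, |iterAvg (L.map (h • ·)) u x - u x
      - h ^ 2 / 2 * (L.map fun s => dirDeriv s (dirDeriv s u) x).sum| ≤ C * h ^ 3 := by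
  induction L with
  | nil => exact ⟨0, le_rfl, fun h _ x => by simp [iterAvg_nil]⟩
  | cons t L ih =>
    obtain ⟨C₁, hC₁, h₁⟩ := ih
    have hS : IsTest fun x => (L.map fun s => dirDeriv s (dirDeriv s u) x).sum :=
      IsTest.listSum L fun s => (hu.dirDeriv s).dirDeriv s
    set S : E → ℝ := fun x => (L.map fun s => dirDeriv s (dirDeriv s u) x).sum
    obtain ⟨C₂, hC₂, h₂⟩ := exists_symAvg_sub_le hu t
    obtain ⟨C₃, hC₃, h₃⟩ := exists_symAvg_sub_self_le hS t
    refine ⟨C₁ + C₂ + C₃, by positivity, fun h hh x => ?_⟩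
    have e1 := abs_symAvg_le (h₁ h hh) (h • t) x
    have e2 := h₂ h hh x
    have e3 := mul_le_mul_of_nonneg_left (h₃ h hh x) (by positivity : 0 ≤ h ^ 2 / 2)
    rw [← abs_of_nonneg (by positivity : 0 ≤ h ^ 2 / 2), ← abs_mul,
      abs_of_nonneg (by positivity : 0 ≤ h ^ 2 / 2)] at e3
    simp only [List.map_cons, iterAvg_cons, List.sum_cons]
    change |symAvg (h • t) (iterAvg (L.map (h • ·)) u) x - u x - h ^ 2 / 2 *
      (dirDeriv t (dirDeriv t u) x + S x)| ≤ _
    simp only [symAvg_apply] at *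
    have e4 : 0 ≤ C₃ * h ^ 3 := by positivity
    rw [abs_le] at *
    constructor <;> linarith

theorem exists_radius_iterAvg (hu : IsTest u) (L : List E) : ∃ R : ℝ, 0 ≤ R ∧
    ∀ h : ℝ, 0 < h → h ≤ 1 → ∀ x, R < ‖x‖ → iterAvg (L.map (h • ·)) u x = 0 := by
  induction L with
  | nil =>
    obtain ⟨R, hR, h⟩ := hu.exists_radius
    exact ⟨R, hR, fun _ _ _ x hx => h x hx⟩
  | cons t L ih =>
    obtain ⟨R, hR, ih⟩ := ih
    refine ⟨R + ‖t‖, by positivity, fun h h0 h1 x hx => ?_⟩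
    have ht : ‖h • t‖ ≤ ‖t‖ := by
      rw [norm_smul, Real.norm_eq_abs, abs_of_pos h0]
      exact mul_le_of_le_one_left (norm_nonneg _) h1
    have h2 : ‖x‖ - ‖h • t‖ ≤ ‖x + h • t‖ := by
      simpa using norm_sub_norm_le x (-(h • t))
    have h3 : ‖x‖ - ‖h • t‖ ≤ ‖x - h • t‖ := norm_sub_norm_le x (h • t)
    simp only [List.map_cons, iterAvg_cons]
    rw [symAvg_apply, ih h h0 h1 _ (by linarith), ih h h0 h1 _ (by linarith)]
    simp

theorem centralDiff_centralDiff_apply (s : E) (u : E → ℝ) (x : E) :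
    centralDiff s (centralDiff s u) x = 2 * (symAvg ((2 : ℝ) • s) u x - u x) := by
  simp only [centralDiff_apply, symAvg_apply, two_smul]
  rw [add_sub_cancel_right, sub_add_cancel, ← add_assoc, ← sub_sub]
  ring

variable [ProperSpace E] [MeasurableSpace E] [BorelSpace E] {μ : Measure E}
  [IsFiniteMeasureOnCompacts μ]

/-- A discrete-to-continuous form of the `L^p` bound for second derivatives by the sum of second
derivatives in finitely many directions. -/
theorem exists_integral_dirDeriv_dirDeriv_le [μ.IsAddRightInvariant] {p : ℝ} (hp : 1 < p) :
    ∃ C : ℝ, 0 < C ∧ ∀ (L : List E) (s : E), s ∈ L → ∀ u : E → ℝ, IsTest u →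
      ∫ x, |dirDeriv s (dirDeriv s u) x| ^ p ∂μ ≤
        C * ∫ x, |(L.map fun t => dirDeriv t (dirDeriv t u) x).sum| ^ p ∂μ := by
  have hp0 : 0 < p := by linarith
  obtain ⟨C, hC, hCZ⟩ := exists_integral_centralDiff_le (μ := μ) hp
  refine ⟨C, hC, fun L s hs u hu => ?_⟩
  set uss := dirDeriv s (dirDeriv s u) with huss_def
  have huss : IsTest uss := (hu.dirDeriv s).dirDeriv s
  have hS : IsTest fun x => (L.map fun s => dirDeriv s (dirDeriv s u) x).sum :=
    IsTest.listSum L fun s => (hu.dirDeriv s).dirDeriv s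
  set S : E → ℝ := fun x => (L.map fun s => dirDeriv s (dirDeriv s u) x).sum with hS_def
  set h : ℕ → ℝ := fun k => 1 / ((k : ℝ) + 1) with hh_def
  have h0 : ∀ k, 0 < h k := fun k => by positivity
  have h1 : ∀ k, h k ≤ 1 := fun k => by
    rw [hh_def]
    dsimp only
    rw [div_le_one (by positivity)]
    linarith [(Nat.cast_nonneg k : (0 : ℝ) ≤ k)]
  set f : ℕ → E → ℝ := fun k x =>
    (iterAvg (L.map (h k • ·)) u x - u x) / h k ^ 2 with hf_def
  set g : ℕ → E → ℝ := fun k x =>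
    centralDiff (h k • s) (centralDiff (h k • s) u) x / h k ^ 2 with hg_def
  have hgf : ∀ k, ∫ x, |g k x| ^ p ∂μ ≤ C * ∫ x, |f k x| ^ p ∂μ := by
    intro k
    have := hCZ (L.map (h k • ·)) (h k • s) (List.mem_map_of_mem hs) u hu.isCc
    have e : ∀ a : ℝ, |a / h k ^ 2| ^ p = |a| ^ p / (h k ^ 2) ^ p := fun a => by
      rw [abs_div, div_rpow (abs_nonneg _) (abs_nonneg _), abs_of_pos (pow_pos (h0 k) 2)]
    simp only [hf_def, hg_def, e, integral_div]
    rw [← mul_div_assoc]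
    have := h0 k
    gcongr
  obtain ⟨C₁, hC₁, e₁⟩ := exists_iterAvg_sub_le hu L
  obtain ⟨C₂, hC₂, e₂⟩ := exists_symAvg_sub_le hu ((2 : ℝ) • s)
  obtain ⟨R₁, hR₁, r₁⟩ := exists_radius_iterAvg hu L
  obtain ⟨R₂, hR₂, r₂⟩ := exists_radius_iterAvg hu [(2 : ℝ) • s]
  obtain ⟨R, hR, r⟩ := hu.exists_radius
  have lf : Filter.Tendsto (fun k => ∫ x, |f k x| ^ p ∂μ) Filter.atTop
      (nhds (∫ x, |1 / 2 * S x| ^ p ∂μ)) := by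
    refine tendsto_integral_abs_rpow (C := C₁) (R := max R R₁) hp0 (fun k => ?_)
      (hS.isCc.comp_left (m := fun t => 1 / 2 * t) (by fun_prop) (by simp)) (fun k x => ?_)
      fun k x hx => ?_
    · exact ((hu.isCc.iterAvg _).1.sub hu.isCc.1).div_const _
    · have := e₁ (h k) (h0 k) x
      have hk := h0 k
      have e : f k x - 1 / 2 * S x =
          (iterAvg (L.map (h k • ·)) u x - u x - h k ^ 2 / 2 * S x) / h k ^ 2 := by
        simp only [hf_def]; field_simp
      rw [e, abs_div, abs_of_pos (pow_pos hk 2), div_le_iff₀ (pow_pos hk 2)]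
      calc _ ≤ C₁ * h k ^ 3 := this
        _ = C₁ * h k * h k ^ 2 := by ring
    · simp only [hf_def]
      rw [r₁ _ (h0 k) (h1 k) x ((le_max_right _ _).trans_lt hx),
        r x ((le_max_left _ _).trans_lt hx)]
      simp
  have lg : Filter.Tendsto (fun k => ∫ x, |g k x| ^ p ∂μ) Filter.atTop
      (nhds (∫ x, |4 * uss x| ^ p ∂μ)) := by
    have hsm : ∀ k, (2 : ℝ) • h k • s = h k • (2 : ℝ) • s := fun k => smul_comm _ _ _
    refine tendsto_integral_abs_rpow (C := 2 * C₂) (R := max R R₂) hp0 (fun k => ?_)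
      (huss.isCc.comp_left (m := fun t => 4 * t) (by fun_prop) (by simp)) (fun k x => ?_)
      fun k x hx => ?_
    · exact ((hu.isCc.centralDiff _).centralDiff _).1.div_const _
    · have := e₂ (h k) (h0 k) x
      have hk := h0 k
      have e3 : dirDeriv ((2 : ℝ) • s) (dirDeriv ((2 : ℝ) • s) u) x = 4 * uss x := by
        have e4 : dirDeriv ((2 : ℝ) • s) u = fun y => 2 * dirDeriv s u y :=
          funext fun y => dirDeriv_smul_left 2 s u y
        rw [dirDeriv_smul_left, e4, dirDeriv_const_mul _ _ (hu.dirDeriv s).differentiable]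
        simp only [huss_def]
        ring
      have e : g k x - 4 * uss x = 2 * (symAvg (h k • (2 : ℝ) • s) u x - u x -
          h k ^ 2 / 2 * (4 * uss x)) / h k ^ 2 := by
        simp only [hg_def, centralDiff_centralDiff_apply, hsm]; field_simp
      rw [e3] at this
      rw [e, abs_div, abs_mul, abs_two, abs_of_pos (pow_pos hk 2), div_le_iff₀ (pow_pos hk 2)]
      calc _ ≤ 2 * (C₂ * h k ^ 3) := by gcongr
        _ = 2 * C₂ * h k * h k ^ 2 := by ring
    · simp only [hg_def, centralDiff_centralDiff_apply, hsm]
      have := r₂ _ (h0 k) (h1 k) x ((le_max_right _ _).trans_lt hx)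
      simp only [List.map_cons, List.map_nil, iterAvg_cons, iterAvg_nil] at this
      rw [this, r x ((le_max_left _ _).trans_lt hx)]
      simp
  have key := le_of_tendsto_of_tendsto' lg (lf.const_mul C) hgf
  have m1 : ∫ x, |uss x| ^ p ∂μ ≤ ∫ x, |4 * uss x| ^ p ∂μ := by
    refine integral_mono (huss.isCc.abs_rpow hp0).integrable
      ((huss.isCc.comp_left (m := fun t => 4 * t) (by fun_prop) (by simp)).abs_rpow
        hp0).integrable fun x => rpow_le_rpow (abs_nonneg _) ?_ hp0.le
    rw [abs_mul, abs_of_pos (by norm_num : (0 : ℝ) < 4)]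
    linarith [abs_nonneg (uss x)]
  have m2 : ∫ x, |1 / 2 * S x| ^ p ∂μ ≤ ∫ x, |S x| ^ p ∂μ := by
    refine integral_mono ((hS.isCc.comp_left (m := fun t => 1 / 2 * t) (by fun_prop)
      (by simp)).abs_rpow hp0).integrable (hS.isCc.abs_rpow hp0).integrable
      fun x => rpow_le_rpow (abs_nonneg _) ?_ hp0.le
    rw [abs_mul, abs_of_pos (by norm_num : (0 : ℝ) < 1 / 2)]
    linarith [abs_nonneg (S x)]
  calc _ ≤ _ := m1
    _ ≤ _ := key
    _ ≤ _ := by gcongr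

end TestFunctions

section MixedDerivatives

variable {n : ℕ}

theorem laplacian_eq_sum_dirDeriv (u : EuclideanSpace ℝ (Fin n) → ℝ) :
    laplacian u = fun x => ∑ i : Fin n, dirDeriv (EuclideanSpace.single i 1)
      (dirDeriv (EuclideanSpace.single i 1) u) x := rfl

theorem IsTest.laplacian {u : EuclideanSpace ℝ (Fin n) → ℝ} (hu : IsTest u) :
    IsTest (laplacian u) :=
  IsTest.sum fun _ _ => (hu.dirDeriv _).dirDeriv _

theorem dirDeriv_add_dirDeriv_add {E : Type*} [NormedAddCommGroup E] [NormedSpace ℝ E]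
    {u : E → ℝ} (hu : IsTest u) (a b : E) (x : E) :
    dirDeriv (a + b) (dirDeriv (a + b) u) x = dirDeriv a (dirDeriv a u) x +
      2 * dirDeriv a (dirDeriv b u) x + dirDeriv b (dirDeriv b u) x := by
  have h : dirDeriv (a + b) u = fun y => dirDeriv a u y + dirDeriv b u y :=
    funext fun y => dirDeriv_add_left a b u y
  rw [h, dirDeriv_add _ (hu.dirDeriv a).differentiable (hu.dirDeriv b).differentiable]
  simp only [dirDeriv_add_left]
  rw [dirDeriv_comm hu.1 b a]
  ring

theorem dirDeriv_sub_dirDeriv_sub {E : Type*} [NormedAddCommGroup E] [NormedSpace ℝ E]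
    {u : E → ℝ} (hu : IsTest u) (a b : E) (x : E) :
    dirDeriv (a - b) (dirDeriv (a - b) u) x = dirDeriv a (dirDeriv a u) x -
      2 * dirDeriv a (dirDeriv b u) x + dirDeriv b (dirDeriv b u) x := by
  have h : ∀ (w : E → ℝ), dirDeriv (-b) w = fun y => (-1) * dirDeriv b w y := fun w =>
    funext fun y => by rw [← neg_one_smul ℝ b, dirDeriv_smul_left]
  rw [sub_eq_add_neg, dirDeriv_add_dirDeriv_add hu, h u,
    dirDeriv_const_mul _ _ (hu.dirDeriv b).differentiable,
    dirDeriv_const_mul _ _ (hu.dirDeriv b).differentiable, h]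
  ring

/-- The Calderón–Zygmund bound for mixed second derivatives by the Laplacian. -/
theorem exists_integral_mixed_le_laplacian {p : ℝ} (hp : 1 < p) (n : ℕ) : ∃ C : ℝ, 0 < C ∧
    ∀ u : EuclideanSpace ℝ (Fin n) → ℝ, IsTest u → ∀ i j : Fin n,
      ∫ x, |dirDeriv (EuclideanSpace.single i 1) (dirDeriv (EuclideanSpace.single j 1) u) x| ^ p ≤
        C * ∫ x, |laplacian u x| ^ p := by
  have hp0 : 0 < p := by linarith
  obtain ⟨C, hC, h⟩ := exists_integral_dirDeriv_dirDeriv_le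
    (μ := (volume : Measure (EuclideanSpace ℝ (Fin n)))) hp
  refine ⟨C * (4 * n + 1) ^ p, by positivity, fun u hu i j => ?_⟩
  set e : Fin n → EuclideanSpace ℝ (Fin n) := fun i => EuclideanSpace.single i 1 with he
  set L : List (EuclideanSpace ℝ (Fin n)) :=
    ((Finset.univ : Finset (Fin n × Fin n)).toList.map fun k => e k.1 + e k.2) ++
      ((Finset.univ : Finset (Fin n × Fin n)).toList.map fun k => e k.1 - e k.2)
  have hsum : ∀ x, (L.map fun t => dirDeriv t (dirDeriv t u) x).sum =
      4 * n * laplacian u x := by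
    intro x
    rw [List.map_append, List.sum_append, List.map_map, List.map_map,
      Finset.sum_map_toList, Finset.sum_map_toList, ← Finset.sum_add_distrib]
    have : ∀ k : Fin n × Fin n,
        ((fun t => dirDeriv t (dirDeriv t u) x) ∘ fun k => e k.1 + e k.2) k +
        ((fun t => dirDeriv t (dirDeriv t u) x) ∘ fun k => e k.1 - e k.2) k =
        2 * (dirDeriv (e k.1) (dirDeriv (e k.1) u) x + dirDeriv (e k.2) (dirDeriv (e k.2) u) x) :=
      fun k => by
        simp only [Function.comp_apply, dirDeriv_add_dirDeriv_add hu,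
          dirDeriv_sub_dirDeriv_sub hu]
        ring
    rw [Finset.sum_congr rfl fun k _ => this k, ← Finset.mul_sum]
    simp only [Finset.sum_add_distrib, Fintype.sum_prod_type,
      laplacian_eq_sum_dirDeriv, Finset.sum_const, Finset.card_univ, Fintype.card_fin, he,
      nsmul_eq_mul, ← Finset.mul_sum]
    ring
  have hplus := h L (e i + e j) (List.mem_append_left _
    (List.mem_map.2 ⟨(i, j), by simp, rfl⟩)) u hu
  have hminus := h L (e i - e j) (List.mem_append_right _
    (List.mem_map.2 ⟨(i, j), by simp, rfl⟩)) u hu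
  have hP : IsTest (dirDeriv (e i + e j) (dirDeriv (e i + e j) u)) :=
    (hu.dirDeriv _).dirDeriv _
  have hM : IsTest (dirDeriv (e i - e j) (dirDeriv (e i - e j) u)) :=
    (hu.dirDeriv _).dirDeriv _
  have hmain : ∫ x, |dirDeriv (e i) (dirDeriv (e j) u) x| ^ p ≤
      1 / 2 * (∫ x, |dirDeriv (e i + e j) (dirDeriv (e i + e j) u) x| ^ p) +
      1 / 2 * (∫ x, |dirDeriv (e i - e j) (dirDeriv (e i - e j) u) x| ^ p) := by
    rw [← integral_const_mul, ← integral_const_mul, ← integral_add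
      ((hP.isCc.abs_rpow hp0).integrable.const_mul _)
      ((hM.isCc.abs_rpow hp0).integrable.const_mul _)]
    refine integral_mono (((hu.dirDeriv _).dirDeriv _).isCc.abs_rpow hp0).integrable
      (((hP.isCc.abs_rpow hp0).integrable.const_mul _).add
        ((hM.isCc.abs_rpow hp0).integrable.const_mul _)) fun x => ?_
    have hc := (convexOn_rpow hp.le).2
      (abs_nonneg (dirDeriv (e i + e j) (dirDeriv (e i + e j) u) x))
      (abs_nonneg (dirDeriv (e i - e j) (dirDeriv (e i - e j) u) x))
      (by norm_num : (0 : ℝ) ≤ 1 / 2) (by norm_num : (0 : ℝ) ≤ 1 / 2) (by norm_num)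
    refine le_trans (rpow_le_rpow (abs_nonneg _) ?_ hp0.le) hc
    have e4 : dirDeriv (e i) (dirDeriv (e j) u) x =
        1 / 4 * (dirDeriv (e i + e j) (dirDeriv (e i + e j) u) x -
          dirDeriv (e i - e j) (dirDeriv (e i - e j) u) x) := by
      rw [dirDeriv_add_dirDeriv_add hu, dirDeriv_sub_dirDeriv_sub hu]; ring
    rw [e4, abs_mul, abs_of_pos (by norm_num : (0 : ℝ) < 1 / 4), smul_eq_mul, smul_eq_mul]
    have := abs_sub (dirDeriv (e i + e j) (dirDeriv (e i + e j) u) x)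
      (dirDeriv (e i - e j) (dirDeriv (e i - e j) u) x)
    have h0 := abs_nonneg (dirDeriv (e i + e j) (dirDeriv (e i + e j) u) x)
    have h1 := abs_nonneg (dirDeriv (e i - e j) (dirDeriv (e i - e j) u) x)
    linarith
  have hlap : ∫ x, |(L.map fun t => dirDeriv t (dirDeriv t u) x).sum| ^ p ≤
      (4 * n + 1) ^ p * ∫ x, |laplacian u x| ^ p := by
    rw [← integral_const_mul]
    simp only [hsum]
    refine integral_mono ((hu.laplacian.isCc.comp_left (m := fun t => 4 * n * t) (by fun_prop)
      (by simp)).abs_rpow hp0).integrable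
      ((hu.laplacian.isCc.abs_rpow hp0).integrable.const_mul _) fun x => ?_
    dsimp only
    rw [← mul_rpow (by positivity) (abs_nonneg _), abs_mul,
      abs_of_nonneg (by positivity : (0 : ℝ) ≤ 4 * n)]
    have := abs_nonneg (laplacian u x)
    gcongr
    linarith
  have := mul_le_mul_of_nonneg_left hlap hC.le
  linarith

end MixedDerivatives

section Mollification

open Filter Topology NNReal

variable {E : Type*} [NormedAddCommGroup E] [InnerProductSpace ℝ E] [FiniteDimensional ℝ E]
  [MeasurableSpace E] [BorelSpace E] {μ : Measure E} [μ.IsAddHaarMeasure] {f φ : E → ℝ} {K : ℝ≥0}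

open ContinuousLinearMap in
theorem fderiv_convolution_eq_integral_lineDeriv (hφ : LipschitzWith K φ) {ρ : E → ℝ}
    (hρ : IsTest ρ) (x v : E) :
    fderiv ℝ (convolution φ ρ (mul ℝ ℝ) μ) x v = ∫ t, ρ (x - t) • lineDeriv ℝ φ t v ∂μ := by
  have φl : LocallyIntegrable φ μ := hφ.continuous.locallyIntegrable
  rw [(hρ.2.hasFDerivAt_convolution_right (mul ℝ ℝ) φl (hρ.1.of_le (by simp)) x).fderiv,
    convolution_precompR_apply _ φl (hρ.2.fderiv ℝ) (hρ.1.continuous_fderiv (by simp)),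
    convolution_def]
  have gs : ContDiff ℝ (⊤ : ℕ∞) fun t => ρ (x - t) := hρ.1.comp (by fun_prop)
  have gc : HasCompactSupport fun t => ρ (x - t) :=
    hρ.2.comp_homeomorph (Homeomorph.subLeft x)
  obtain ⟨D, gl⟩ := (gs.of_le (by simp : (1 : WithTop ℕ∞) ≤ _)).lipschitzWith_of_hasCompactSupport
    gc (by simp)
  simp only [smul_eq_mul]
  simp_rw [mul_comm (ρ _)]
  rw [LipschitzWith.integral_lineDeriv_mul_eq (μ := μ) hφ gl gc v]
  refine integral_congr_ae (.of_forall fun t => ?_)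
  have hd : HasFDerivAt (fun t => ρ (x - t)) (-(fderiv ℝ ρ (x - t))) t := by
    have h1 : HasFDerivAt ρ (fderiv ℝ ρ (x - t)) (x - t) :=
      (hρ.1.differentiable (by simp) _).hasFDerivAt
    refine (h1.comp t ((hasFDerivAt_id t).const_sub x)).congr_fderiv ?_
    ext; simp
  dsimp only
  rw [hd.differentiableAt.lineDeriv_eq_fderiv, hd.fderiv]
  simp [mul_comm]

open ContinuousLinearMap in
/-- Lipschitz functions with compact support are approximated by smooth ones, with bounded and
almost everywhere convergent derivatives. -/
theorem exists_mollification (hφ : LipschitzWith K φ) (hc : HasCompactSupport φ)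
    (h0 : ∀ x, 0 ≤ φ x) {δ : ℝ} (hδ : 0 < δ) : ∃ F : ℕ → E → ℝ,
      (∀ k, IsTest (F k)) ∧ (∀ k x, 0 ≤ F k x) ∧
      (∀ k, tsupport (F k) ⊆ Metric.cthickening δ (tsupport φ)) ∧
      (∀ k x v, |fderiv ℝ (F k) x v| ≤ K * ‖v‖) ∧
      ∀ v, ∀ᵐ x ∂μ, Tendsto (fun k => fderiv ℝ (F k) x v) atTop (𝓝 (fderiv ℝ φ x v)) := by
  obtain ⟨b, hbo, hbi⟩ : ∃ b : ℕ → ContDiffBump (0 : E), (∀ k : ℕ, (b k).rOut = δ / (k + 1)) ∧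
      ∀ k, (b k).rIn = (b k).rOut / 2 :=
    ⟨fun k => ⟨δ / (k + 1) / 2, δ / (k + 1), by positivity, half_lt_self (by positivity)⟩,
      fun _ => rfl, fun _ => rfl⟩
  have hb : ∀ k, (b k).rOut ≤ δ := fun k => by
    rw [hbo]
    exact div_le_self hδ.le (by linarith [(Nat.cast_nonneg k : (0 : ℝ) ≤ k)])
  obtain ⟨ρ, hρ⟩ : ∃ ρ : ℕ → E → ℝ, ∀ k, ρ k = (b k).normed μ := ⟨_, fun _ => rfl⟩
  have ρs : ∀ k, ContDiff ℝ (⊤ : ℕ∞) (ρ k) := fun k => hρ k ▸ (b k).contDiff_normed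
  have ρc : ∀ k, HasCompactSupport (ρ k) := fun k => hρ k ▸ (b k).hasCompactSupport_normed
  have ρ0 : ∀ k x, 0 ≤ ρ k x := fun k x => hρ k ▸ (b k).nonneg_normed x
  have φl : LocallyIntegrable φ μ := hφ.continuous.locallyIntegrable
  obtain ⟨F, hF⟩ : ∃ F : ℕ → E → ℝ, ∀ k, F k = convolution φ (ρ k) (mul ℝ ℝ) μ :=
    ⟨_, fun _ => rfl⟩
  have hFsupp : ∀ k, tsupport (F k) ⊆ Metric.cthickening δ (tsupport φ) := by
    intro k
    refine closure_minimal ?_ Metric.isClosed_cthickening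
    rw [hF]
    refine (support_convolution_subset (mul ℝ ℝ)).trans ?_
    rintro _ ⟨x, hx, y, hy, rfl⟩
    rw [hρ, (b k).support_normed_eq, mem_ball_zero_iff] at hy
    refine Metric.mem_cthickening_of_dist_le _ x δ _ (subset_tsupport φ hx) ?_
    rw [dist_eq_norm, add_sub_cancel_left]
    exact hy.le.trans (hb k)
  have hFc : ∀ k, HasCompactSupport (F k) := fun k => hF k ▸ hc.convolution (mul ℝ ℝ) (ρc k)
  have hfd : ∀ k x v, fderiv ℝ (F k) x v = ∫ t, ρ k (x - t) • lineDeriv ℝ φ t v ∂μ :=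
    fun k => hF k ▸ fderiv_convolution_eq_integral_lineDeriv hφ ⟨ρs k, ρc k⟩
  refine ⟨F, fun k => ⟨hF k ▸ (ρc k).contDiff_convolution_right (mul ℝ ℝ) φl (ρs k), hFc k⟩,
    fun k x => hF k ▸ integral_nonneg fun t => mul_nonneg (h0 _) (ρ0 _ _), hFsupp, fun k x v => ?_,
    fun v => ?_⟩
  · rw [hfd]
    have hi : Integrable (fun t => ρ k (x - t)) μ :=
      ((ρs k).continuous.comp (by fun_prop)).integrable_of_hasCompactSupport
        ((ρc k).comp_homeomorph (Homeomorph.subLeft x))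
    have h1 : ∫ t, ρ k (x - t) * (K * ‖v‖) ∂μ = K * ‖v‖ := by
      rw [integral_mul_const, integral_sub_left_eq_self, hρ, (b k).integral_normed, one_mul]
    rw [← h1, ← Real.norm_eq_abs]
    refine norm_integral_le_of_norm_le (hi.mul_const _) (.of_forall fun t => ?_)
    rw [norm_smul, Real.norm_eq_abs, abs_of_nonneg (ρ0 _ _)]
    exact mul_le_mul_of_nonneg_left (norm_lineDeriv_le_of_lipschitz ℝ hφ) (ρ0 _ _)
  · have hb0 : Tendsto (fun k => (b k).rOut) atTop (𝓝 0) := by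
      have := (tendsto_one_div_add_atTop_nhds_zero_nat (𝕜 := ℝ)).const_mul δ
      simpa [hbo, div_eq_mul_inv] using this
    have hconv := ContDiffBump.ae_convolution_tendsto_right_of_locallyIntegrable (μ := μ) (K := 2)
      hb0 (.of_forall fun k => by rw [hbi]; linarith) (hφ.locallyIntegrable_lineDeriv v)
    filter_upwards [hconv, hφ.ae_differentiableAt (μ := μ)] with x hx hd
    rw [← hd.lineDeriv_eq_fderiv]
    refine hx.congr fun k => ?_
    rw [hfd, convolution_lsmul_swap, hρ]

theorem measurable_gradient (f : E → ℝ) : Measurable (gradient f) :=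
  (LinearIsometryEquiv.continuous _).measurable.comp (measurable_fderiv ℝ f)

/-- Weak superharmonicity may be tested against Lipschitz functions. -/
theorem integral_inner_gradient_nonneg_of_lipschitz {Ω : Set E} (hΩ : IsOpen Ω)
    {K' : ℝ≥0} (hf : LipschitzWith K' f)
    (H : ∀ ψ : E → ℝ, IsTest ψ → tsupport ψ ⊆ Ω → (∀ x, 0 ≤ ψ x) →
      0 ≤ ∫ x in Ω, ⟪gradient f x, gradient ψ x⟫ ∂μ)
    (hφ : LipschitzWith K φ) (hc : HasCompactSupport φ) (hs : tsupport φ ⊆ Ω)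
    (h0 : ∀ x, 0 ≤ φ x) : 0 ≤ ∫ x in Ω, ⟪gradient f x, gradient φ x⟫ ∂μ := by
  obtain ⟨δ, hδ, hδΩ⟩ := IsCompact.exists_cthickening_subset_open hc hΩ hs
  obtain ⟨F, hF, hF0, hFs, hFb, hFt⟩ := exists_mollification (μ := μ) hφ hc h0 hδ
  have b := stdOrthonormalBasis ℝ E
  have hexp : ∀ (ψ : E → ℝ) x, ⟪gradient f x, gradient ψ x⟫ =
      ∑ i, fderiv ℝ f x (b i) * fderiv ℝ ψ x (b i) := by
    intro ψ x
    rw [← b.sum_inner_mul_inner]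
    refine Finset.sum_congr rfl fun i _ => ?_
    rw [inner_gradient_left, inner_gradient_right]
    rfl
  set S := Metric.cthickening δ (tsupport φ) with hS
  have hSc : IsCompact S := IsCompact.cthickening hc
  have hlim : Tendsto (fun k => ∫ x in Ω, ⟪gradient f x, gradient (F k) x⟫ ∂μ) atTop
      (𝓝 (∫ x in Ω, ⟪gradient f x, gradient φ x⟫ ∂μ)) := by
    refine tendsto_integral_of_dominated_convergence
      (S.indicator fun _ => ∑ i, (K' : ℝ) * ‖b i‖ * (K * ‖b i‖)) (fun k => ?_) ?_ (fun k => ?_) ?_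
    · exact ((measurable_gradient f).inner (measurable_gradient (F k))).aestronglyMeasurable
    · refine Integrable.restrict ?_
      refine (integrable_indicator_iff hSc.isClosed.measurableSet).2 ?_
      exact continuousOn_const.integrableOn_compact hSc
    · refine .of_forall fun x => ?_
      by_cases hx : x ∈ S
      · rw [Set.indicator_of_mem hx, hexp]
        refine (norm_sum_le _ _).trans (Finset.sum_le_sum fun i _ => ?_)
        rw [norm_mul]
        refine mul_le_mul ?_ (hFb k x _) (norm_nonneg _) (by positivity)
        refine (ContinuousLinearMap.le_opNorm _ _).trans ?_
        gcongr
        exact norm_fderiv_le_of_lipschitz ℝ hf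
      · have hz : fderiv ℝ (F k) x = 0 := by
          by_contra h
          exact hx (hFs k (support_fderiv_subset ℝ h))
        rw [hexp, hz]
        simp [hx]
    · have : ∀ᵐ x ∂μ, ∀ i, Tendsto (fun k => fderiv ℝ (F k) x (b i)) atTop
          (𝓝 (fderiv ℝ φ x (b i))) := ae_all_iff.2 fun i => hFt (b i)
      filter_upwards [ae_restrict_of_ae this] with x hx
      simp only [hexp]
      exact tendsto_finsetSum _ fun i _ => (hx i).const_mul _
  exact ge_of_tendsto' hlim fun k => H (F k) (hF k) ((hFs k).trans hδΩ) (hF0 k)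

end Mollification

section DistanceWeights

open Metric NNReal

theorem lipschitzOnWith_rpow_Ici {δ : ℝ} (hδ : 0 < δ) {s : ℝ} (hs : s ≤ 1) :
    LipschitzOnWith (Real.toNNReal (|s| * δ ^ (s - 1))) (fun t : ℝ => t ^ s) (Set.Ici δ) := by
  refine (convex_Ici δ).lipschitzOnWith_of_nnnorm_hasDerivWithin_le (f' := fun t => s * t ^ (s - 1))
    (fun t ht => (Real.hasDerivAt_rpow_const (Or.inl (hδ.trans_le ht).ne')).hasDerivWithinAt)
    fun t ht => ?_
  rw [← NNReal.coe_le_coe, Real.coe_toNNReal _ (by positivity), coe_nnnorm, norm_mul,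
    Real.norm_eq_abs, Real.norm_of_nonneg (Real.rpow_nonneg (hδ.trans_le ht).le _)]
  exact mul_le_mul_of_nonneg_left (Real.rpow_le_rpow_of_nonpos hδ ht (by linarith)) (abs_nonneg _)

theorem rpow_sub_one_mul_le {p ε a b : ℝ} (hp : 1 < p) (hε : 0 < ε) (ha : 0 ≤ a) (hb : 0 ≤ b) :
    a ^ (p - 1) * b ≤ ε * a ^ p + ε ^ (1 - p) * b ^ p := by
  have hap : a ^ p = a ^ (p - 1) * a := by
    rw [← Real.rpow_add_one' ha (by linarith), sub_add_cancel]
  have hbp : b ^ p = b ^ (p - 1) * b := by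
    rw [← Real.rpow_add_one' hb (by linarith), sub_add_cancel]
  rcases le_total b (ε * a) with h | h
  · have h1 : a ^ (p - 1) * b ≤ ε * a ^ p := by
      rw [hap]
      nlinarith [Real.rpow_nonneg ha (p - 1)]
    have h2 : 0 ≤ ε ^ (1 - p) * b ^ p := by positivity
    linarith
  · have h1 : a ^ (p - 1) ≤ ε ^ (1 - p) * b ^ (p - 1) := by
      have h3 : a ≤ b / ε := by rwa [le_div_iff₀ hε, mul_comm]
      refine (Real.rpow_le_rpow ha h3 (by linarith)).trans_eq ?_
      rw [Real.div_rpow hb hε.le, show 1 - p = -(p - 1) by ring, Real.rpow_neg hε.le]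
      field_simp
    have h2 : 0 ≤ ε * a ^ p := by positivity
    rw [hbp]
    nlinarith

variable {E : Type*} [NormedAddCommGroup E] {Ω : Set E} {u : E → ℝ}

theorem LipschitzWith.mul_of_bounded {f g : E → ℝ} {K L : ℝ≥0} (hf : LipschitzWith K f)
    (hg : LipschitzWith L g) {A B : ℝ≥0} (hA : ∀ x, |f x| ≤ A) (hB : ∀ x, |g x| ≤ B) :
    LipschitzWith (A * L + K * B) fun x => f x * g x := by
  refine LipschitzWith.of_dist_le_mul fun x y => ?_
  have h1 := hf.dist_le_mul x y
  have h2 := hg.dist_le_mul x y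
  rw [Real.dist_eq] at *
  calc |f x * g x - f y * g y| = |f x * (g x - g y) + (f x - f y) * g y| := by ring_nf
    _ ≤ |f x| * |g x - g y| + |f x - f y| * |g y| := by
      rw [← abs_mul, ← abs_mul]; exact abs_add_le _ _
    _ ≤ A * (L * dist x y) + K * dist x y * B := by gcongr <;> apply_assumption
    _ = _ := by push_cast; ring

theorem abs_rpow_mul_max_infDist {δ p : ℝ} (hp : p ≠ 0) (hs : ∀ x ∈ tsupport u, δ < infDist x Ωᶜ)
    (q : ℝ) (x : E) : |u x| ^ p * max (infDist x Ωᶜ) δ ^ (-q) = |u x| ^ p / infDist x Ωᶜ ^ q := by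
  by_cases hx : x ∈ tsupport u
  · rw [max_eq_left (hs x hx).le, Real.rpow_neg infDist_nonneg, div_eq_mul_inv]
  · simp [image_eq_zero_of_notMem_tsupport hx, Real.zero_rpow hp]

theorem exists_lt_infDist_tsupport (hΩ : IsOpen Ω) (hne : Ωᶜ.Nonempty) (hu : HasCompactSupport u)
    (hs : tsupport u ⊆ Ω) : ∃ δ, 0 < δ ∧ ∀ x ∈ tsupport u, δ < infDist x Ωᶜ := by
  obtain ⟨a, ha, h⟩ := IsCompact.exists_forall_le' (f := fun x => infDist x Ωᶜ) hu
    (continuous_infDist_pt _).continuousOn (a := 0) fun x hx =>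
      (hΩ.isClosed_compl.notMem_iff_infDist_pos hne).1 fun h => h (hs hx)
  exact ⟨a / 2, half_pos ha, fun x hx => (half_lt_self ha).trans_le (h x hx)⟩

theorem tsupport_dirDeriv_subset [NormedSpace ℝ E] (v : E) (u : E → ℝ) :
    tsupport (dirDeriv v u) ⊆ tsupport u := by
  refine (closure_mono fun x hx => ?_).trans (tsupport_fderiv_subset ℝ (f := u))
  exact fun h => hx (by simp [dirDeriv, h])

theorem IsTest.integrable_abs_rpow_div [NormedSpace ℝ E] [MeasurableSpace E] [BorelSpace E]
    {μ : Measure E} [IsFiniteMeasureOnCompacts μ] (hΩ : IsOpen Ω) (hne : Ωᶜ.Nonempty)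
    {p : ℝ} (hp : 0 < p) (hu : IsTest u) (hs : tsupport u ⊆ Ω) (q : ℝ) :
    Integrable (fun x => |u x| ^ p / infDist x Ωᶜ ^ q) μ := by
  obtain ⟨δ, hδ, hsδ⟩ := exists_lt_infDist_tsupport hΩ hne hu.2 hs
  have hup : IsCc fun x => |u x| ^ p := hu.isCc.abs_rpow hp
  simp only [← abs_rpow_mul_max_infDist hp.ne' hsδ]
  refine (hup.1.mul (Continuous.rpow_const ?_ fun x => Or.inl ?_)).integrable_of_hasCompactSupport
    hup.2.mul_right
  · exact (continuous_infDist_pt _).max continuous_const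
  · exact (hδ.trans_le (le_max_right _ _)).ne'

end DistanceWeights

section Hardy

open Filter Topology NNReal Metric

variable {E : Type*} [NormedAddCommGroup E] [InnerProductSpace ℝ E] [FiniteDimensional ℝ E]
  {Ω : Set E} {u : E → ℝ}

/-- The distance to the boundary satisfies the eikonal equation wherever it is differentiable. -/
theorem norm_gradient_infDist (hΩ : IsOpen Ω) (hne : Ωᶜ.Nonempty) {x : E} (hx : x ∈ Ω)
    (hd : DifferentiableAt ℝ (fun y => infDist y Ωᶜ) x) :
    ‖gradient (fun y => infDist y Ωᶜ) x‖ = 1 := by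
  have hnorm : ‖gradient (fun y => infDist y Ωᶜ) x‖ = ‖fderiv ℝ (fun y => infDist y Ωᶜ) x‖ :=
    LinearIsometryEquiv.norm_map _ _
  rw [hnorm]
  refine le_antisymm ?_ ?_
  · simpa using norm_fderiv_le_of_lipschitz ℝ (x₀ := x) (lipschitz_infDist_pt Ωᶜ)
  obtain ⟨z, hz, hxz⟩ := hΩ.isClosed_compl.exists_infDist_eq_dist hne x
  have hpos : 0 < ‖z - x‖ := norm_pos_iff.2 (sub_ne_zero.2 fun h => hz (h ▸ hx))
  have hline : HasDerivAt (fun t : ℝ => x + t • (z - x)) (z - x) 0 := by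
    simpa using ((hasDerivAt_id (0 : ℝ)).smul_const (z - x)).const_add x
  have hder : HasDerivAt (fun t : ℝ => infDist (x + t • (z - x)) Ωᶜ - (1 - t) * ‖z - x‖)
      (fderiv ℝ (fun y => infDist y Ωᶜ) x (z - x) - (-1) * ‖z - x‖) 0 := by
    have hd' : HasFDerivAt (fun y => infDist y Ωᶜ) (fderiv ℝ (fun y => infDist y Ωᶜ) x)
        (x + (0 : ℝ) • (z - x)) := by simpa using hd.hasFDerivAt
    exact (hd'.comp_hasDerivAt (0 : ℝ) hline).sub
      (((hasDerivAt_id (0 : ℝ)).const_sub 1).mul_const _)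
  have hmax : IsLocalMax (fun t : ℝ => infDist (x + t • (z - x)) Ωᶜ - (1 - t) * ‖z - x‖) 0 := by
    filter_upwards [Iio_mem_nhds one_pos] with t ht
    have h1 : infDist (x + t • (z - x)) Ωᶜ ≤ (1 - t) * ‖z - x‖ := by
      refine (infDist_le_dist_of_mem hz).trans_eq ?_
      rw [dist_comm, dist_eq_norm, show z - (x + t • (z - x)) = (1 - t) • (z - x) by module,
        norm_smul, Real.norm_of_nonneg (sub_nonneg.2 (Set.mem_Iio.1 ht).le)]
    have h2 : infDist x Ωᶜ = ‖z - x‖ := by rw [hxz, dist_comm, dist_eq_norm]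
    simp only [zero_smul, add_zero, h2]
    linarith
  have h0 := hmax.hasDerivAt_eq_zero hder
  have h1 := (abs_le.1 ((fderiv ℝ (fun y => infDist y Ωᶜ) x).le_opNorm (z - x))).1
  refine le_of_mul_le_mul_right ?_ hpos
  linarith

end Hardy

section HardyInequality

open Filter Topology NNReal Metric

variable {E : Type*} [NormedAddCommGroup E] [InnerProductSpace ℝ E] [FiniteDimensional ℝ E]
  [MeasurableSpace E] [BorelSpace E] {μ : Measure E} [μ.IsAddHaarMeasure] {Ω : Set E} {u : E → ℝ}

/-- The pointwise form of the weighted Young inequality behind Hardy's inequality. -/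
theorem mul_rpow_hardy_le {p q a b t w : ℝ} (hp : 1 < p) (hq : 1 < q) (hb : 0 ≤ b) (ht : 0 < t)
    (hw : |w| ≤ b) : |a| ^ p * ((1 - q) * t ^ (1 - q - 1) * 1) +
      t ^ (1 - q) * (p * |a| ^ (p - 2) * a * w) ≤
      p * ((q - 1) / (2 * p)) ^ (1 - p) * (b ^ p * t ^ (p - q)) -
        (q - 1) / 2 * (|a| ^ p * t ^ (-q)) := by
  have hε : 0 < (q - 1) / (2 * p) := div_pos (by linarith) (by linarith)
  have h1 : |a| ^ (p - 2) * a * w ≤ |a| ^ (p - 1) * b := by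
    have h2 : |a| ^ (p - 2) * |a| = |a| ^ (p - 1) := by
      rw [← Real.rpow_add_one' (abs_nonneg a) (by linarith)]
      ring_nf
    rw [← h2, mul_assoc, mul_assoc]
    refine mul_le_mul_of_nonneg_left ?_ (by positivity)
    calc a * w ≤ |a * w| := le_abs_self _
      _ = |a| * |w| := abs_mul _ _
      _ ≤ |a| * b := by gcongr
  have h3 := rpow_sub_one_mul_le hp hε (div_nonneg (abs_nonneg a) ht.le) hb
  rw [Real.div_rpow (abs_nonneg a) ht.le, Real.div_rpow (abs_nonneg a) ht.le] at h3
  have h4 : t ^ (1 - q) = t ^ (p - q) / t ^ (p - 1) := by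
    rw [← Real.rpow_sub ht]; congr 1; ring
  have h5 : t ^ (-q) = t ^ (p - q) / t ^ p := by
    rw [← Real.rpow_sub ht]; congr 1; ring
  have h6 : (q - 1) / 2 = p * ((q - 1) / (2 * p)) := by field_simp
  have h7 : t ^ (1 - q) * (|a| ^ (p - 1) * b) ≤
      (q - 1) / (2 * p) * (|a| ^ p * t ^ (-q)) +
        ((q - 1) / (2 * p)) ^ (1 - p) * (b ^ p * t ^ (p - q)) := by
    rw [h4, h5]
    have := mul_le_mul_of_nonneg_left h3 (Real.rpow_nonneg ht.le (p - q))
    refine le_of_eq_of_le ?_ (this.trans_eq ?_) <;> ring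
  have h8 := mul_le_mul_of_nonneg_left h1 (Real.rpow_nonneg ht.le (1 - q))
  have h9 := mul_le_mul_of_nonneg_left (h8.trans h7) (by linarith : (0 : ℝ) ≤ p)
  have h10 : (1 : ℝ) - q - 1 = -q := by ring
  rw [h10]
  have h11 : p * ((q - 1) / (2 * p)) * (|a| ^ p * t ^ (-q)) =
    (q - 1) / 2 * (|a| ^ p * t ^ (-q)) := by rw [h6]
  linarith

/-- `Δd ≤ 0` on `Ω` in the sense of distributions, for `d` the distance to the complement. -/
def IsWeaklyMeanConvex (μ : Measure E) (Ω : Set E) : Prop :=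
  ∀ φ : E → ℝ, IsTest φ → tsupport φ ⊆ Ω → (∀ x, 0 ≤ φ x) →
    0 ≤ ∫ x in Ω, ⟪gradient (fun y => infDist y Ωᶜ) x, gradient φ x⟫ ∂μ

/-- The `L^p` Hardy inequality with the distance truncated away from the support of `u`. -/
theorem IsWeaklyMeanConvex.integral_le_truncated (hΩ : IsOpen Ω) (hne : Ωᶜ.Nonempty)
    (hmc : IsWeaklyMeanConvex μ Ω) {p q : ℝ} (hp : 1 < p) (hq : 1 < q) (hu : IsTest u)
    {δ : ℝ} (hδ : 0 < δ) (hs : ∀ x ∈ tsupport u, δ < infDist x Ωᶜ) (hsΩ : tsupport u ⊆ Ω) :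
    (q - 1) / 2 * ∫ x, |u x| ^ p * max (infDist x Ωᶜ) δ ^ (-q) ∂μ ≤
      p * ((q - 1) / (2 * p)) ^ (1 - p) *
        ∫ x, ‖fderiv ℝ u x‖ ^ p * max (infDist x Ωᶜ) δ ^ (p - q) ∂μ := by
  set d : E → ℝ := fun x => infDist x Ωᶜ with hd
  set M : E → ℝ := fun x => max (d x) δ with hM
  have hdl : LipschitzWith 1 d := lipschitz_infDist_pt _
  have hMl : LipschitzWith 1 M := hdl.max_const δ
  have hM0 : ∀ x, 0 < M x := fun x => hδ.trans_le (le_max_right _ _)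
  have hMr : ∀ r : ℝ, Continuous fun x => M x ^ r := fun r =>
    hMl.continuous.rpow_const fun x => Or.inl (hM0 x).ne'
  set φ : E → ℝ := fun x => |u x| ^ p * M x ^ (1 - q) with hφ
  have hφ0 : ∀ x, 0 ≤ φ x := fun x => by have := hM0 x; positivity
  have hup : IsCc fun x => |u x| ^ p := hu.isCc.abs_rpow (by linarith)
  have hφsupp : tsupport φ ⊆ tsupport u := by
    refine closure_mono fun x hx => ?_
    contrapose! hx
    simp only [Function.mem_support, not_not] at hx ⊢
    simp [hφ, hx, Real.zero_rpow (by linarith : p ≠ 0)]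
  have hφc : HasCompactSupport φ := hup.2.mul_right
  obtain ⟨K, hφl⟩ : ∃ K, LipschitzWith K φ := by
    obtain ⟨K₁, hK₁⟩ : ∃ K, LipschitzWith K fun x => |u x| ^ p :=
      ContDiff.lipschitzWith_of_hasCompactSupport hup.2
        (ContDiff.norm_rpow (hu.1.of_le (by simp)) hp) one_ne_zero
    obtain ⟨B, hB⟩ := hup.2.exists_bound_of_continuous hup.1
    have hB0 : 0 ≤ B := (norm_nonneg _).trans (hB 0)
    have hl : LipschitzWith (Real.toNNReal (|1 - q| * δ ^ (1 - q - 1)) * 1)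
        fun x => M x ^ (1 - q) := by
      have := (lipschitzOnWith_rpow_Ici hδ (by linarith : 1 - q ≤ 1)).comp
        (hMl.lipschitzOnWith (s := Set.univ)) fun x _ => le_max_right (d x) δ
      exact lipschitzOnWith_univ.1 this
    refine ⟨_, hK₁.mul_of_bounded hl (A := ⟨B, hB0⟩) (B := ⟨δ ^ (1 - q), by positivity⟩) hB
      fun x => ?_⟩
    rw [abs_of_nonneg (Real.rpow_nonneg (hM0 x).le _)]
    exact Real.rpow_le_rpow_of_nonpos hδ (le_max_right _ _) (by linarith)
  have h0 := integral_inner_gradient_nonneg_of_lipschitz hΩ hdl hmc hφl hφc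
    (hφsupp.trans hsΩ) hφ0
  set G : E → ℝ := fun x => p * ((q - 1) / (2 * p)) ^ (1 - p) *
    (‖fderiv ℝ u x‖ ^ p * M x ^ (p - q)) - (q - 1) / 2 * (|u x| ^ p * M x ^ (-q)) with hG
  have hi1 : Integrable (fun x => |u x| ^ p * M x ^ (-q)) μ :=
    (hup.1.mul (hMr _)).integrable_of_hasCompactSupport hup.2.mul_right
  have hi2 : Integrable (fun x => ‖fderiv ℝ u x‖ ^ p * M x ^ (p - q)) μ := by
    refine Continuous.integrable_of_hasCompactSupport (.mul (.rpow_const (.norm ?_) ?_) (hMr _)) ?_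
    · exact hu.1.continuous_fderiv (by simp)
    · exact fun x => Or.inr (by linarith)
    · exact ((hu.2.fderiv ℝ).norm.comp_left (g := fun t : ℝ => t ^ p)
        (Real.zero_rpow (by linarith))).mul_right
  have hGi : Integrable G μ := (hi2.const_mul _).sub (hi1.const_mul _)
  have hoff : ∀ x, x ∉ tsupport u → G x = 0 := fun x hx => by
    have h1 : u x = 0 := image_eq_zero_of_notMem_tsupport hx
    have h2 : fderiv ℝ u x = 0 := by
      by_contra h
      exact hx (support_fderiv_subset ℝ h)
    simp [hG, h1, h2, Real.zero_rpow (by linarith : p ≠ 0)]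
  have hgoff : ∀ x, x ∉ tsupport u → fderiv ℝ φ x = 0 := fun x hx => by
    by_contra h
    exact hx (hφsupp (support_fderiv_subset ℝ h))
  have hle : ∫ x in Ω, ⟪gradient d x, gradient φ x⟫ ∂μ ≤ ∫ x in Ω, G x ∂μ := by
    refine integral_mono_ae ?_ hGi.restrict ?_
    · refine Integrable.restrict (Integrable.mono'
        (g := (tsupport u).indicator fun _ => ((1 : ℝ≥0) : ℝ) * K) ?_ ?_ ?_)
      · refine (integrable_indicator_iff (isClosed_tsupport u).measurableSet).2 ?_
        exact continuousOn_const.integrableOn_compact hu.2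
      · exact ((measurable_gradient d).inner (measurable_gradient φ)).aestronglyMeasurable
      · refine .of_forall fun x => ?_
        by_cases hx : x ∈ tsupport u
        · rw [Set.indicator_of_mem hx]
          refine (norm_inner_le_norm _ _).trans ?_
          gcongr
          · exact (LinearIsometryEquiv.norm_map _ _).trans_le (norm_fderiv_le_of_lipschitz ℝ hdl)
          · exact (LinearIsometryEquiv.norm_map _ _).trans_le (norm_fderiv_le_of_lipschitz ℝ hφl)
        · rw [inner_gradient_right, hgoff x hx]
          simp [hx]
    · filter_upwards [ae_restrict_of_ae (hdl.ae_differentiableAt (μ := μ)),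
        ae_restrict_mem hΩ.measurableSet] with x hdx hxΩ
      by_cases hx : x ∈ tsupport u
      swap
      · rw [hoff x hx, inner_gradient_right, hgoff x hx]
        simp
      have hdpos : 0 < d x := hδ.trans (hs x hx)
      have hMd : M x = d x := max_eq_left (hs x hx).le
      have hφd : φ =ᶠ[𝓝 x] fun y => |u y| ^ p * d y ^ (1 - q) := by
        filter_upwards [hdl.continuous.continuousAt.eventually (lt_mem_nhds (hs x hx))] with y hy
        simp only [hφ, hM, max_eq_left (le_of_lt hy)]
      have hder := (((hasDerivAt_abs_rpow (u x) hp).comp_hasFDerivAt x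
        (hu.differentiable x).hasFDerivAt).mul (hdx.hasFDerivAt.rpow_const
          (p := 1 - q) (Or.inl hdpos.ne'))).congr_of_eventuallyEq hφd
      have hgd : fderiv ℝ d x (gradient d x) = 1 := by
        rw [← inner_gradient_left, real_inner_self_eq_norm_sq,
          norm_gradient_infDist hΩ hne hxΩ hdx, one_pow]
      have hgu : |fderiv ℝ u x (gradient d x)| ≤ ‖fderiv ℝ u x‖ := by
        have := (fderiv ℝ u x).le_opNorm (gradient d x)
        rwa [norm_gradient_infDist hΩ hne hxΩ hdx, mul_one] at this
      have hY := mul_rpow_hardy_le hp hq (norm_nonneg (fderiv ℝ u x)) hdpos hgu (a := u x)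
      rw [inner_gradient_right, hder.fderiv]
      simp only [hG, hMd, add_apply, _root_.smul_apply, smul_eq_mul, hgd,
        Function.comp_apply, conj_trivial]
      linarith
  rw [setIntegral_eq_integral_of_forall_compl_eq_zero fun x hx =>
    hoff x fun h => hx (hsΩ h)] at hle
  have := h0.trans hle
  rw [hG, integral_sub (hi2.const_mul _) (hi1.const_mul _), integral_const_mul,
    integral_const_mul] at this
  linarith

end HardyInequality

section Coordinates

open Metric

variable {n : ℕ}

theorem norm_fderiv_le_sum_abs_dirDeriv (u : EuclideanSpace ℝ (Fin n) → ℝ)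
    (x : EuclideanSpace ℝ (Fin n)) :
    ‖fderiv ℝ u x‖ ≤ ∑ i, |dirDeriv (EuclideanSpace.single i 1) u x| := by
  refine ContinuousLinearMap.opNorm_le_bound _ (Finset.sum_nonneg fun _ _ => abs_nonneg _)
    fun v => ?_
  have hv : v = ∑ i, v i • EuclideanSpace.single i (1 : ℝ) := by
    have := (EuclideanSpace.basisFun (Fin n) ℝ).sum_repr v
    simpa using this.symm
  conv_lhs => rw [hv]
  rw [map_sum, Finset.sum_mul]
  refine (norm_sum_le _ _).trans (Finset.sum_le_sum fun i _ => ?_)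
  rw [map_smul, norm_smul, mul_comm]
  exact mul_le_mul_of_nonneg_left (PiLp.norm_apply_le v i) (norm_nonneg _)

theorem norm_fderiv_rpow_le {p : ℝ} (hp : 1 < p) (u : EuclideanSpace ℝ (Fin n) → ℝ)
    (x : EuclideanSpace ℝ (Fin n)) :
    ‖fderiv ℝ u x‖ ^ p ≤
      (n : ℝ) ^ (p - 1) * ∑ i, |dirDeriv (EuclideanSpace.single i 1) u x| ^ p := by
  refine (Real.rpow_le_rpow (norm_nonneg _) (norm_fderiv_le_sum_abs_dirDeriv u x)
    (by linarith)).trans ?_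
  simpa using Real.rpow_sum_le_const_mul_sum_rpow Finset.univ
    (fun i => dirDeriv (EuclideanSpace.single i 1) u x) hp.le

/-- **Hardy's inequality** on weakly mean convex sets. -/
theorem exists_integral_hardy_le {p q : ℝ} (hp : 1 < p) (hq : 1 < q) (n : ℕ) :
    ∃ C : ℝ, 0 ≤ C ∧ ∀ Ω : Set (EuclideanSpace ℝ (Fin n)), IsOpen Ω → Ωᶜ.Nonempty →
      IsWeaklyMeanConvex volume Ω → ∀ u, IsTest u → tsupport u ⊆ Ω →
        ∫ x, |u x| ^ p / infDist x Ωᶜ ^ q ≤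
          C * ∑ i, ∫ x, |dirDeriv (EuclideanSpace.single i 1) u x| ^ p /
            infDist x Ωᶜ ^ (q - p) := by
  have hq1 : 0 < q - 1 := by linarith
  have hp0 : 0 < p := by linarith
  refine ⟨2 / (q - 1) * (p * ((q - 1) / (2 * p)) ^ (1 - p)) * (n : ℝ) ^ (p - 1), by positivity,
    fun Ω hΩ hne hmc u hu hs => ?_⟩
  obtain ⟨δ, hδ, hsδ⟩ := exists_lt_infDist_tsupport hΩ hne hu.2 hs
  have h := hmc.integral_le_truncated hΩ hne hp hq hu hδ hsδ hs
  simp only [abs_rpow_mul_max_infDist hp0.ne' hsδ] at h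
  have hD : ∀ i, tsupport (dirDeriv (EuclideanSpace.single i 1) u) ⊆ tsupport u :=
    fun i => tsupport_dirDeriv_subset _ u
  have hint := fun i => (hu.dirDeriv (EuclideanSpace.single i 1)).integrable_abs_rpow_div
    (μ := volume) hΩ hne hp0 ((hD i).trans hs) (q - p)
  have h2 : ∫ x, ‖fderiv ℝ u x‖ ^ p * max (infDist x Ωᶜ) δ ^ (p - q) ≤
      (n : ℝ) ^ (p - 1) * ∑ i, ∫ x, |dirDeriv (EuclideanSpace.single i 1) u x| ^ p /
            infDist x Ωᶜ ^ (q - p) := by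
    rw [← integral_finsetSum _ fun i _ => hint i, ← integral_const_mul]
    refine integral_mono_of_nonneg (.of_forall fun x => ?_)
      ((integrable_finsetSum _ fun i _ => hint i).const_mul _) (.of_forall fun x => ?_)
    · have := hδ.trans_le (le_max_right (infDist x Ωᶜ) δ)
      positivity
    · have h3 := mul_le_mul_of_nonneg_right (norm_fderiv_rpow_le hp u x)
        (Real.rpow_nonneg (hδ.trans_le (le_max_right (infDist x Ωᶜ) δ)).le (p - q))
      refine h3.trans_eq ?_
      dsimp only
      rw [mul_assoc, Finset.sum_mul]
      congr 1
      refine Finset.sum_congr rfl fun i _ => ?_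
      rw [← abs_rpow_mul_max_infDist hp0.ne' (fun x hx => hsδ x (hD i hx)), neg_sub]
  have h4 := h.trans (mul_le_mul_of_nonneg_left h2 (by positivity))
  have h5 := mul_le_mul_of_nonneg_left h4 (by positivity : 0 ≤ 2 / (q - 1))
  rw [← mul_assoc, show 2 / (q - 1) * ((q - 1) / 2) = 1 by field_simp, one_mul] at h5
  rw [mul_assoc, mul_assoc]
  exact h5

end Coordinates

section IteratedLaplacian

variable {n : ℕ} {u : EuclideanSpace ℝ (Fin n) → ℝ}

theorem dirDeriv_laplacian (hu : IsTest u) (v : EuclideanSpace ℝ (Fin n)) :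
    dirDeriv v (laplacian u) = laplacian (dirDeriv v u) := by
  rw [laplacian_eq_sum_dirDeriv, laplacian_eq_sum_dirDeriv]
  funext x
  rw [dirDeriv, fderiv_fun_sum fun i _ => ((hu.dirDeriv _).dirDeriv _).differentiable x,
    sum_apply]
  refine Finset.sum_congr rfl fun i _ => ?_
  rw [dirDeriv_comm hu.1 _ v, dirDeriv_comm (hu.dirDeriv _).1 _ v]
  rfl

theorem IsTest.laplacian_iterate (hu : IsTest u) (k : ℕ) : IsTest (_root_.laplacian^[k] u) := by
  induction k with
  | zero => exact hu
  | succ k ih => rw [Function.iterate_succ_apply']; exact ih.laplacian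

theorem dirDeriv_laplacian_iterate (hu : IsTest u) (v : EuclideanSpace ℝ (Fin n)) (k : ℕ) :
    dirDeriv v (laplacian^[k] u) = laplacian^[k] (dirDeriv v u) := by
  induction k with
  | zero => rfl
  | succ k ih =>
    rw [Function.iterate_succ_apply', dirDeriv_laplacian (hu.laplacian_iterate k), ih,
      ← Function.iterate_succ_apply' (f := laplacian)]

theorem tsupport_laplacian_subset (u : EuclideanSpace ℝ (Fin n) → ℝ) :
    tsupport (laplacian u) ⊆ tsupport u := by
  refine closure_minimal (fun x hx => ?_) (isClosed_tsupport u)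
  contrapose! hx
  rw [laplacian_eq_sum_dirDeriv, Function.mem_support, not_not]
  refine Finset.sum_eq_zero fun i _ => image_eq_zero_of_notMem_tsupport fun h => hx ?_
  exact tsupport_dirDeriv_subset _ _ (tsupport_dirDeriv_subset _ _ h)

theorem tsupport_laplacian_iterate_subset (u : EuclideanSpace ℝ (Fin n) → ℝ) (k : ℕ) :
    tsupport (laplacian^[k] u) ⊆ tsupport u := by
  induction k with
  | zero => rfl
  | succ k ih =>
    rw [Function.iterate_succ_apply']
    exact (tsupport_laplacian_subset _).trans ih

theorem norm_gradient_eq_norm_fderiv (u : EuclideanSpace ℝ (Fin n) → ℝ)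
    (x : EuclideanSpace ℝ (Fin n)) : ‖gradient u x‖ = ‖fderiv ℝ u x‖ :=
  LinearIsometryEquiv.norm_map _ _

theorem halfLaplacianAbs_eq_zero_of_notMem_tsupport (m : ℕ) {x : EuclideanSpace ℝ (Fin n)}
    (hx : x ∉ tsupport u) : halfLaplacianAbs m u x = 0 := by
  have hk : x ∉ tsupport (laplacian^[m / 2] u) :=
    fun h => hx (tsupport_laplacian_iterate_subset u _ h)
  rw [halfLaplacianAbs]
  split_ifs
  · rw [image_eq_zero_of_notMem_tsupport hk, abs_zero]
  · rw [norm_gradient_eq_norm_fderiv, norm_eq_zero]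
    by_contra h
    exact hk (support_fderiv_subset ℝ h)

theorem IsTest.integrable_norm_fderiv_rpow {p : ℝ} (hp : 0 < p) (hu : IsTest u) :
    Integrable fun x => ‖fderiv ℝ u x‖ ^ p := by
  have : IsCc fun x => ‖fderiv ℝ u x‖ :=
    ⟨(hu.1.continuous_fderiv (by simp)).norm, (hu.2.fderiv ℝ).norm⟩
  simpa using (this.abs_rpow hp).integrable

theorem IsTest.integral_dirDeriv_rpow_le {p : ℝ} (hp : 0 < p) (hu : IsTest u) (i : Fin n) :
    ∫ x, |_root_.dirDeriv (EuclideanSpace.single i 1) u x| ^ p ≤ ∫ x, ‖fderiv ℝ u x‖ ^ p := by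
  refine integral_mono ((hu.dirDeriv _).isCc.abs_rpow hp).integrable
    (hu.integrable_norm_fderiv_rpow hp) fun x => ?_
  refine Real.rpow_le_rpow (abs_nonneg _) ?_ hp.le
  simpa [_root_.dirDeriv] using (fderiv ℝ u x).le_opNorm (EuclideanSpace.single i (1 : ℝ))

/-- Mixed second derivatives of `u` cost at most two orders of the iterated Laplacian. -/
theorem exists_integral_halfLaplacianAbs_mixed_le {p : ℝ} (hp : 1 < p) (n m : ℕ) :
    ∃ C : ℝ, 0 ≤ C ∧ ∀ u : EuclideanSpace ℝ (Fin n) → ℝ, IsTest u → ∀ i j,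
      ∫ x, halfLaplacianAbs m (dirDeriv (EuclideanSpace.single i 1)
        (dirDeriv (EuclideanSpace.single j 1) u)) x ^ p ≤
        C * ∫ x, halfLaplacianAbs (m + 2) u x ^ p := by
  have hp0 : 0 < p := by linarith
  obtain ⟨C, hC, h⟩ := exists_integral_mixed_le_laplacian hp n
  have hk : (m + 2) / 2 = m / 2 + 1 := by omega
  by_cases hm : Even m
  · refine ⟨C, hC.le, fun u hu i j => ?_⟩
    simp only [halfLaplacianAbs, hm, Nat.even_add, even_two, if_true, hk,
      Function.iterate_succ_apply']
    rw [← dirDeriv_laplacian_iterate (hu.dirDeriv _), ← dirDeriv_laplacian_iterate hu]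
    exact h _ (hu.laplacian_iterate _) i j
  · refine ⟨(n : ℝ) ^ (p - 1) * (n * C), by positivity, fun u hu i j => ?_⟩
    simp only [halfLaplacianAbs, hm, Nat.even_add, even_two, iff_true, if_false, hk,
      Function.iterate_succ_apply', norm_gradient_eq_norm_fderiv]
    rw [← dirDeriv_laplacian_iterate (hu.dirDeriv _), ← dirDeriv_laplacian_iterate hu]
    set w := laplacian^[m / 2] u with hw
    have hwt : IsTest w := hu.laplacian_iterate _
    set e : Fin n → EuclideanSpace ℝ (Fin n) := fun i => EuclideanSpace.single i 1
    have hint := fun l => (((hwt.dirDeriv (e j)).dirDeriv (e i)).dirDeriv (e l)).isCc.abs_rpow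
      hp0 |>.integrable (μ := volume)
    calc ∫ x, ‖fderiv ℝ (dirDeriv (e i) (dirDeriv (e j) w)) x‖ ^ p
        ≤ ∫ x, (n : ℝ) ^ (p - 1) *
            ∑ l, |dirDeriv (e l) (dirDeriv (e i) (dirDeriv (e j) w)) x| ^ p :=
          integral_mono (((hwt.dirDeriv _).dirDeriv _).integrable_norm_fderiv_rpow hp0)
            ((integrable_finsetSum _ fun l _ => hint l).const_mul _) fun x =>
              norm_fderiv_rpow_le hp _ x
      _ = (n : ℝ) ^ (p - 1) *
            ∑ l, ∫ x, |dirDeriv (e i) (dirDeriv (e j) (dirDeriv (e l) w)) x| ^ p := by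
          rw [integral_const_mul, integral_finsetSum _ fun l _ => hint l]
          congr 1
          refine Finset.sum_congr rfl fun l _ => ?_
          rw [dirDeriv_comm (hwt.dirDeriv _).1 (e l), dirDeriv_comm hwt.1 (e l)]
      _ ≤ (n : ℝ) ^ (p - 1) * ∑ l : Fin n, C * ∫ x, ‖fderiv ℝ (laplacian w) x‖ ^ p := by
          gcongr with l
          refine (h _ (hwt.dirDeriv _) i j).trans ?_
          rw [← dirDeriv_laplacian hwt]
          exact mul_le_mul_of_nonneg_left (hwt.laplacian.integral_dirDeriv_rpow_le hp0 l) hC.le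
      _ = _ := by
          rw [Finset.sum_const, Finset.card_univ, Fintype.card_fin, nsmul_eq_mul]
          ring

open Metric in
theorem exists_integral_rellich_le {p : ℝ} (hp : 1 < p) (n m : ℕ) :
    ∃ C : ℝ, 0 ≤ C ∧ ∀ Ω : Set (EuclideanSpace ℝ (Fin n)), IsOpen Ω → Ωᶜ.Nonempty →
      IsWeaklyMeanConvex volume Ω → ∀ u, IsTest u → tsupport u ⊆ Ω →
        ∫ x, |u x| ^ p / infDist x Ωᶜ ^ ((m : ℝ) * p) ≤
          C * ∫ x, halfLaplacianAbs m u x ^ p := by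
  have hp0 : 0 < p := by linarith
  induction m using Nat.twoStepInduction with
  | zero => exact ⟨1, zero_le_one, fun Ω _ _ _ u _ _ => by simp [halfLaplacianAbs]⟩
  | one =>
    obtain ⟨C, hC, h⟩ := exists_integral_hardy_le hp hp n
    refine ⟨C * n, by positivity, fun Ω hΩ hne hmc u hu hs => ?_⟩
    have h1 := h Ω hΩ hne hmc u hu hs
    simp only [sub_self, Real.rpow_zero, div_one] at h1
    simp only [Nat.cast_one, one_mul, halfLaplacianAbs, Nat.not_even_one, if_false,
      norm_gradient_eq_norm_fderiv, Nat.reduceDiv, Function.iterate_zero, id]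
    refine h1.trans ?_
    rw [mul_assoc]
    refine mul_le_mul_of_nonneg_left ?_ hC
    refine (Finset.sum_le_sum fun i _ => hu.integral_dirDeriv_rpow_le hp0 i).trans_eq ?_
    simp
  | more m ih _ =>
    obtain ⟨C, hC, h⟩ := ih
    have hq₂ : 1 < ((m : ℝ) + 1) * p := by nlinarith [(Nat.cast_nonneg m : (0 : ℝ) ≤ m)]
    obtain ⟨C₁, hC₁, h₁⟩ := exists_integral_hardy_le hp
      (by linarith : 1 < ((m : ℝ) + 1) * p + p) n
    obtain ⟨C₂, hC₂, h₂⟩ := exists_integral_hardy_le hp hq₂ n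
    obtain ⟨C₃, hC₃, h₃⟩ := exists_integral_halfLaplacianAbs_mixed_le hp n m
    refine ⟨C₁ * (n * (C₂ * (n * (C * C₃)))), by positivity, fun Ω hΩ hne hmc u hu hs => ?_⟩
    set e : Fin n → EuclideanSpace ℝ (Fin n) := fun i => EuclideanSpace.single i 1
    set I := ∫ x, halfLaplacianAbs (m + 2) u x ^ p with hI
    have hs₁ : ∀ i, tsupport (dirDeriv (e i) u) ⊆ Ω :=
      fun i => (tsupport_dirDeriv_subset _ _).trans hs
    have hs₂ : ∀ i j, tsupport (dirDeriv (e j) (dirDeriv (e i) u)) ⊆ Ω :=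
      fun i j => (tsupport_dirDeriv_subset _ _).trans (hs₁ i)
    have hmix : ∀ i j, ∫ x, |dirDeriv (e j) (dirDeriv (e i) u) x| ^ p / infDist x Ωᶜ ^ ((m : ℝ) * p)
        ≤ C * C₃ * I := fun i j => by
      refine (h Ω hΩ hne hmc _ ((hu.dirDeriv _).dirDeriv _) (hs₂ i j)).trans ?_
      rw [mul_assoc]
      exact mul_le_mul_of_nonneg_left (h₃ u hu j i) hC
    have hone : ∀ i, ∫ x, |dirDeriv (e i) u x| ^ p / infDist x Ωᶜ ^ (((m : ℝ) + 1) * p)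
        ≤ C₂ * (n * (C * C₃)) * I := fun i => by
      have h4 := h₂ Ω hΩ hne hmc _ (hu.dirDeriv (e i)) (hs₁ i)
      rw [show ((m : ℝ) + 1) * p - p = m * p by ring] at h4
      refine h4.trans ?_
      rw [mul_assoc]
      refine mul_le_mul_of_nonneg_left ?_ hC₂
      refine (Finset.sum_le_sum fun j _ => hmix i j).trans_eq ?_
      simp [mul_assoc]
    have h5 := h₁ Ω hΩ hne hmc u hu hs
    rw [add_sub_cancel_right] at h5
    rw [show ((m + 2 : ℕ) : ℝ) * p = ((m : ℝ) + 1) * p + p by push_cast; ring]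
    refine h5.trans ?_
    rw [mul_assoc]
    refine mul_le_mul_of_nonneg_left ?_ hC₁
    refine (Finset.sum_le_sum fun i _ => hone i).trans_eq ?_
    simp [mul_assoc]

end IteratedLaplacian

/-- **Rellich-type inequality for weakly mean convex domains.**
Let `p > 1` and `n, m ≥ 2`.  There is a constant `c(n,m,p) > 0` such that for every
nonempty open connected weakly mean convex `Ω ⊊ ℝⁿ` and every `u ∈ C_c^∞(Ω)`,
`∫_Ω |Δ^{m/2} u|^p ≥ c(n,m,p) ∫_Ω |u|^p / d^{mp}`. -/
theorem rellich_weakly_mean_convex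
    (p : ℝ) (hp : 1 < p) (n m : ℕ) (hn : 2 ≤ n) (hm : 2 ≤ m) :
    ∃ c : ℝ, 0 < c ∧
      ∀ Ω : Set (EuclideanSpace ℝ (Fin n)),
        IsOpen Ω → Ω.Nonempty → Ω ≠ Set.univ → IsConnected Ω →
        (∀ φ : EuclideanSpace ℝ (Fin n) → ℝ,
          ContDiff ℝ (⊤ : ℕ∞) φ → HasCompactSupport φ → tsupport φ ⊆ Ω → (∀ x, 0 ≤ φ x) →
          0 ≤ ∫ x in Ω, ⟪gradient (fun y => Metric.infDist y Ωᶜ) x, gradient φ x⟫) →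
        ∀ u : EuclideanSpace ℝ (Fin n) → ℝ,
          ContDiff ℝ (⊤ : ℕ∞) u → HasCompactSupport u → tsupport u ⊆ Ω →
          c * ∫ x in Ω, |u x| ^ p / Metric.infDist x Ωᶜ ^ ((m : ℝ) * p)
            ≤ ∫ x in Ω, halfLaplacianAbs m u x ^ p := by
  obtain ⟨C, hC, h⟩ := exists_integral_rellich_le hp n m
  have hp0 : p ≠ 0 := by linarith
  refine ⟨(C + 1)⁻¹, by positivity, fun Ω hΩ _ huniv _ hmc u hu hc hs => ?_⟩
  rw [setIntegral_eq_integral_of_forall_compl_eq_zero fun x hx => by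
      rw [image_eq_zero_of_notMem_tsupport fun h => hx (hs h), abs_zero, Real.zero_rpow hp0,
        zero_div],
    setIntegral_eq_integral_of_forall_compl_eq_zero fun x hx => by
      rw [halfLaplacianAbs_eq_zero_of_notMem_tsupport m fun h => hx (hs h), Real.zero_rpow hp0]]
  have hI : 0 ≤ ∫ x, halfLaplacianAbs m u x ^ p := by
    refine integral_nonneg fun x => Real.rpow_nonneg ?_ _
    rw [halfLaplacianAbs]
    split_ifs <;> positivity
  rw [inv_mul_le_iff₀ (by positivity)]
  refine (h Ω hΩ (Set.nonempty_compl.2 huniv) (fun φ hφ => hmc φ hφ.1 hφ.2) u ⟨hu, hc⟩ hs).trans ?_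
  linarith
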